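/- arXiv:1701.07814 — 6 statements merged into one kernel-verified Lean document; each statement's English description precedes it below -/
import Mathlib

section
/- Let b, c ∈ ℝ and let {H_m(z)} be the sequence of polynomials defined by H_0(z) = 1, H_1(z) = −c, H_2(z) = c² − b, and H_m(z) + c·H_{m−1}(z) + b·H_{m−2}(z) + z·H_{m−3}(z) = 0 for all m ≥ 3. Then every H_m(z) has all its zeros real (a polynomial that is identically zero is regarded as having all zeros real) if and only if either (i) c = 0 and b ≥ 0, or (ii) c ≠ 0 and −1 ≤ b/c² ≤ 1/3. -/
open Polynomial

lemma pf_formula (b c z x y w : ℂ) (E : ℕ → ℂ) (h0 : E 0 = 1) (h1 : E 1 = -c) (h2 : E 2 = c^2-b)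
    (hrec : ∀ m, E (m+3) + c * E (m+2) + b * E (m+1) + z * E m = 0)
    (e1 : x + y + w = -c) (e2 : x*y+x*w+y*w = b) (e3 : x*y*w = -z) (m : ℕ) :
    E m * ((x-y)*(x-w)*(y-w)) = x^(m+2)*(y-w) - y^(m+2)*(x-w) + w^(m+2)*(x-y) := by
  obtain rfl : c = -(x+y+w) := by rw [e1]; ring
  obtain rfl := e2
  obtain rfl : z = -(x*y*w) := by rw [e3]; ring
  induction m using Nat.strong_induction_on with
  | _ m ih =>
    match m with
    | 0 => rw [h0]; ring
    | 1 => rw [h1]; ring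
    | 2 => rw [h2]; ring
    | k+3 =>
      have a0 := ih k (by omega)
      have a1 := ih (k+1) (by omega)
      have a2 := ih (k+2) (by omega)
      linear_combination ((x-y)*(x-w)*(y-w)) * hrec k + (x+y+w) * a2 - (x*y+x*w+y*w) * a1 + (x*y*w)*a0

lemma tr_formula (b c z u v θ : ℝ) (E : ℕ → ℝ) (h0 : E 0 = 1) (h1 : E 1 = -c) (h2 : E 2 = c^2-b)
    (hrec : ∀ m, E (m+3) + c * E (m+2) + b * E (m+1) + z * E m = 0)
    (e1 : 2*u*Real.cos θ + v = -c) (e2 : u^2+2*u*v*Real.cos θ = b) (e3 : u^2*v = -z) (m : ℕ) :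
    E m * (Real.sin θ * (u^2-2*u*v*Real.cos θ + v^2)) =
      u^(m+2)*Real.sin ((m+1)*θ) - v*u^(m+1)*Real.sin ((m+2)*θ) + v^(m+2)*Real.sin θ := by
  obtain ⟨k, hk⟩ : ∃ k, k = Real.cos θ := ⟨_, rfl⟩
  obtain ⟨S, hS⟩ : ∃ S : ℕ → ℝ, ∀ n, S n = Real.sin (n*θ) := ⟨_, fun n => rfl⟩
  have hSr : ∀ n, S (n+2) = 2*k*S (n+1) - S n := by
    intro n
    rw [hS, hS, hS, hk]
    have := Real.sin_add ((n+1)*θ) θ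
    have h' := Real.sin_sub ((n+1)*θ) θ
    push_cast
    rw [show ((n:ℝ)+2)*θ = (n+1)*θ+θ by ring, show (n:ℝ)*θ = (n+1)*θ-θ by ring, this, h']
    ring_nf
  have g : E m * (S 1 * (u^2-2*u*v*k + v^2)) =
      u^(m+2)*S (m+1) - v*u^(m+1)*S (m+2) + v^(m+2)*S 1 := by
    rw [← hk] at e1 e2
    obtain rfl : c = -(2*u*k+v) := by rw [e1]; ring
    obtain rfl := e2
    obtain rfl : z = -(u^2*v) := by rw [e3]; ring
    have hS0 : S 0 = 0 := by rw [hS]; simp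
    have s2 := hSr 0
    have s3 := hSr 1
    have s4 := hSr 2
    norm_num at s2 s3 s4
    rw [hS0] at s2
    induction m using Nat.strong_induction_on with
    | _ m ih =>
      match m with
      | 0 => rw [h0]; norm_num; rw [s2]; ring
      | 1 => rw [h1]; norm_num; rw [s3,s2]; ring
      | 2 => rw [h2]; norm_num; rw [s4,s3,s2]; ring
      | j+3 =>
        have a0 := ih j (by omega)
        have a1 := ih (j+1) (by omega)
        have a2 := ih (j+2) (by omega)
        have t3 := hSr (j+1)
        have t4 := hSr (j+2)
        have t5 := hSr (j+3)
        norm_num [add_assoc] at a0 a1 a2 t3 t4 t5 ⊢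
        rw [t5] 
        rw [t4, t3] 
        rw [t4, t3] at a2
        rw [t3] at a1
        linear_combination (S 1 * (u^2-2*u*v*k + v^2)) * hrec j + (2*u*k+v) * a2 - (u^2+2*u*v*k) * a1 + (u^2*v)*a0
  rw [hS, hS, hS] at g
  push_cast at g
  rw [one_mul, hk] at g
  exact g

lemma all_real (p : ℝ[X]) (n : ℕ) (hp : p ≠ 0) (hd : p.natDegree ≤ n) (s : Finset ℝ)
    (hs : n ≤ s.card + 1) (hr : ∀ r ∈ s, p.eval r = 0) (z : ℂ) (hz : aeval z p = 0) : z.im = 0 := by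
  have hdvd : (∏ r ∈ s, (X - C r)) ∣ p := by
    have := (Multiset.prod_X_sub_C_dvd_iff_le_roots hp s.val).2 (by
      rw [Multiset.le_iff_subset s.nodup]
      intro r h
      rw [mem_roots hp]
      exact hr r h)
    exact this
  obtain ⟨q, rfl⟩ := hdvd
  have hq : q ≠ 0 := right_ne_zero_of_mul hp
  have hP : (∏ r ∈ s, (X - C r)) ≠ 0 := left_ne_zero_of_mul hp
  rw [natDegree_mul hP hq, natDegree_prod_of_monic _ _ (fun r _ => monic_X_sub_C r)] at hd
  simp at hd
  have hq1 : q.natDegree ≤ 1 := by omega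
  rw [map_mul, mul_eq_zero] at hz
  rcases hz with hz | hz
  · rw [map_prod, Finset.prod_eq_zero_iff] at hz
    obtain ⟨r, _, h⟩ := hz
    simp at h
    rw [sub_eq_zero.1 h]
    simp
  · obtain ⟨a, d, rfl⟩ := exists_eq_X_add_C_of_natDegree_le_one hq1
    simp at hz
    have him := congrArg Complex.im hz
    have hre := congrArg Complex.re hz
    simp at him hre
    rcases him with h | h
    · subst h
      simp at hre
      subst hre
      simp at hq
    · exact h

lemma prod_bound (z h : ℂ) (hz : z.im ≠ 0) (s : Multiset ℂ) (hs : ∀ r ∈ s, r.im = 0) :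
    ‖(s.map (fun r => z + h - r)).prod‖ * ‖(s.map (fun r => z - h - r)).prod‖ ≤
     ‖(s.map (fun r => z - r)).prod‖^2 * (1 + ‖h‖^2/z.im^2)^(Multiset.card s) := by
  induction s using Multiset.induction_on with
  | empty => simp
  | cons r s ih =>
    have ih' := ih (fun r hr => hs r (Multiset.mem_cons_of_mem hr))
    have hr := hs r (Multiset.mem_cons_self r s)
    simp only [Multiset.map_cons, Multiset.prod_cons, Multiset.card_cons, norm_mul]
    have key : ‖z + h - r‖ * ‖z - h - r‖ ≤ ‖z - r‖^2 * (1 + ‖h‖^2/z.im^2) := by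
      rw [← norm_mul, show (z+h-r)*(z-h-r) = (z-r)^2 - h^2 by ring]
      have h1 := norm_sub_le ((z-r)^2) (h^2)
      rw [norm_pow, norm_pow] at h1
      have h2 : z.im^2 ≤ ‖z-r‖^2 := by
        have := Complex.abs_im_le_norm (z-r)
        rw [Complex.sub_im, hr, sub_zero] at this
        rw [← sq_abs]
        gcongr
      have h3 : 0 < z.im^2 := by positivity
      have h4 : ‖h‖^2 ≤ ‖z-r‖^2 * (‖h‖^2/z.im^2) := by
        rw [← mul_div_assoc, le_div_iff₀ h3, mul_comm]
        gcongr
      linarith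
    calc _ = (‖z + h - r‖ * ‖z - h - r‖) * (‖(s.map (fun r => z + h - r)).prod‖ * ‖(s.map (fun r => z - h - r)).prod‖) := by ring
      _ ≤ (‖z - r‖^2 * (1 + ‖h‖^2/z.im^2)) * (‖(s.map (fun r => z - r)).prod‖^2 * (1 + ‖h‖^2/z.im^2)^(Multiset.card s)) := by gcongr
      _ = _ := by ring

lemma hyp_bound (p : ℝ[X]) (hp : p = 0 ∨ ∀ z : ℂ, aeval z p = 0 → z.im = 0) (m : ℕ) (hd : p.natDegree ≤ m)
    (z h : ℂ) (hz : z.im ≠ 0) :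
    ‖aeval (z+h) p‖ * ‖aeval (z-h) p‖ ≤ ‖aeval z p‖^2 * (1 + ‖h‖^2/z.im^2)^m := by
  rcases hp with rfl | hp
  · simp
  set P := p.map (algebraMap ℝ ℂ) with hP
  have hev : ∀ w : ℂ, aeval w p = P.leadingCoeff * (P.roots.map (fun r => w - r)).prod := by
    intro w
    rw [← eval_map_algebraMap, ← hP]
    exact (IsAlgClosed.splits P).eval_eq_prod_roots w
  have hroots : ∀ r ∈ P.roots, r.im = 0 := by
    intro r hr
    apply hp
    rw [← eval_map_algebraMap]
    exact (mem_roots'.1 hr).2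
  have hc : Multiset.card P.roots ≤ m := (card_roots' P).trans (natDegree_map_le.trans hd)
  rw [hev, hev, hev, norm_mul, norm_mul, norm_mul]
  have hb := prod_bound z h hz P.roots hroots
  have h1 : (1:ℝ) ≤ 1 + ‖h‖^2/z.im^2 := by
    have : 0 ≤ ‖h‖^2/z.im^2 := by positivity
    linarith
  calc _ = ‖P.leadingCoeff‖^2 * (‖(P.roots.map (fun r => z + h - r)).prod‖ * ‖(P.roots.map (fun r => z - h - r)).prod‖) := by ring
      _ ≤ ‖P.leadingCoeff‖^2 * (‖(P.roots.map (fun r => z - r)).prod‖^2 * (1 + ‖h‖^2/z.im^2)^(Multiset.card P.roots)) := by gcongr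
      _ ≤ ‖P.leadingCoeff‖^2 * (‖(P.roots.map (fun r => z - r)).prod‖^2 * (1 + ‖h‖^2/z.im^2)^m) := by gcongr
      _ = _ := by ring

lemma deg_bound (b c : ℝ) (H : ℕ → Polynomial ℝ)
    (h0 : H 0 = 1) (h1 : H 1 = C (-c)) (h2 : H 2 = C (c ^ 2 - b))
    (hrec : ∀ m, H (m + 3) + C c * H (m + 2) + C b * H (m + 1) + X * H m = 0) (m : ℕ) :
    (H m).natDegree ≤ m/3 := by
  induction m using Nat.strong_induction_on with
  | _ m ih =>
    match m with
    | 0 => rw [h0]; simp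
    | 1 => rw [h1, natDegree_C]
    | 2 => rw [h2, natDegree_C]
    | j+3 =>
      have a0 := ih j (by omega)
      have a1 := ih (j+1) (by omega)
      have a2 := ih (j+2) (by omega)
      have : H (j+3) = -(C c * H (j + 2) + C b * H (j + 1) + X * H j) := by
        linear_combination hrec j
      rw [this, natDegree_neg]
      refine (natDegree_add_le_of_degree_le (natDegree_add_le_of_degree_le (n := (j+3)/3) ?_ ?_) ?_)
      · exact (natDegree_C_mul_le _ _).trans (by omega)
      · exact (natDegree_C_mul_le _ _).trans (by omega)
      · refine natDegree_mul_le.trans ?_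
        rw [natDegree_X]; omega

lemma suff_core (b c : ℝ) (H : ℕ → Polynomial ℝ)
    (h0 : H 0 = 1) (h1 : H 1 = C (-c)) (h2 : H 2 = C (c ^ 2 - b))
    (hrec : ∀ m, H (m + 3) + C c * H (m + 2) + C b * H (m + 1) + X * H m = 0) (m : ℕ)
    (α β : ℝ) (hα : 0 ≤ α) (hβ : β ≤ Real.pi) (u v : ℝ → ℝ)
    (hu : ContinuousOn u (Set.Ioo α β)) (hv : ContinuousOn v (Set.Ioo α β))
    (hpos : ∀ θ ∈ Set.Ioo α β, ∀ θ' ∈ Set.Ioo α β, 0 < u θ * u θ')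
    (hlt : ∀ θ ∈ Set.Ioo α β, |v θ| < |u θ|)
    (e1 : ∀ θ ∈ Set.Ioo α β, 2 * u θ * Real.cos θ + v θ = -c)
    (e2 : ∀ θ ∈ Set.Ioo α β, u θ ^ 2 + 2 * u θ * v θ * Real.cos θ = b)
    (k0 : ℕ) (hk : ∀ i : ℕ, i < m / 3 → ((k0 + 1 + i : ℕ) : ℝ) * Real.pi / (m + 2) ∈ Set.Ioo α β) :
    H m = 0 ∨ ∀ z : ℂ, aeval z (H m) = 0 → z.im = 0 := by
  by_cases hH : H m = 0
  · exact Or.inl hH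
  right
  intro z hz
  set Z : ℝ → ℝ := fun θ => -(u θ ^ 2 * v θ) with hZ
  set G : ℝ → ℝ := fun θ => (H m).eval (Z θ) * u θ ^ m with hG
  set t : ℕ → ℝ := fun i => ((k0 + 1 + i : ℕ) : ℝ) * Real.pi / (m + 2) with ht
  have hm2 : (0:ℝ) < m + 2 := by positivity
  have hsin : ∀ θ ∈ Set.Ioo α β, 0 < Real.sin θ := fun θ h =>
    Real.sin_pos_of_pos_of_lt_pi (lt_of_le_of_lt hα h.1) (lt_of_lt_of_le h.2 hβ)
  have hsc : ∀ θ, Real.sin θ ^ 2 + Real.cos θ ^ 2 = 1 := Real.sin_sq_add_cos_sq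
  have hu0 : ∀ θ ∈ Set.Ioo α β, u θ ≠ 0 := by
    intro θ h h'
    have := hpos θ h θ h
    rw [h'] at this; simp at this
  have hGc : ContinuousOn G (Set.Ioo α β) := by
    apply ContinuousOn.mul
    · exact (H m).continuous.comp_continuousOn (((hu.pow 2).mul hv).neg)
    · exact hu.pow m
  have hsign : ∀ i : ℕ, i < m / 3 → 0 < (-1) ^ (k0 + i) * G (t i) := by
    intro i hi
    have hI := hk i hi
    change t i ∈ _ at hI
    have key := tr_formula b c (Z (t i)) (u (t i)) (v (t i)) (t i) (fun j => (H j).eval (Z (t i)))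
      (by simp [h0]) (by simp [h1]) (by simp [h2])
      (fun j => by
        have := congrArg (eval (Z (t i))) (hrec j)
        simpa using this) (e1 _ hI) (e2 _ hI) (by simp [hZ]) m
    have hs := hsin _ hI
    have a1 : ((m:ℝ)+2) * t i = (k0+1+i : ℕ) * Real.pi := by
      simp only [ht]; field_simp
    have a2 : ((m:ℝ)+1) * t i = (k0+1+i : ℕ) * Real.pi - t i := by
      linear_combination a1
    rw [a1, a2, Real.sin_nat_mul_pi, Real.sin_nat_mul_pi_sub] at key
    have hl := hlt _ hI
    have hu' := hu0 _ hI
    have hp := hsc (t i)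
    set θ := t i with hθ
    set U := u θ
    set V := v θ
    have hQ : 0 < U^2 - 2*U*V*Real.cos θ + V^2 := by
      have : U^2 - 2*U*V*Real.cos θ + V^2 = (V - U*Real.cos θ)^2 + (U * Real.sin θ)^2 := by
        linear_combination (-U^2) * hp
      rw [this]
      have : 0 < (U * Real.sin θ)^2 := by positivity
      positivity
    set Q := U^2 - 2*U*V*Real.cos θ + V^2
    have key2 : eval (Z θ) (H m) * Q = (-1)^(k0+i) * U^(m+2) + V^(m+2) := by
      apply mul_left_cancel₀ hs.ne'
      have : ((-1:ℝ))^(k0+1+i) = - (-1)^(k0+i) := by ring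
      rw [this] at key
      linear_combination key
    have hq : 0 < ((-1) ^ (k0 + i) * G θ) * Q := by
      have e : ((-1) ^ (k0 + i) * G θ) * Q = ((-1)^(k0+i))^2 * (U^m * U^(m+2)) + (-1)^(k0+i) * (U^m * V^(m+2)) := by
        simp only [hG]
        linear_combination ((-1) ^ (k0 + i) * U ^ m) * key2
      rw [e, ← pow_mul, mul_comm (k0+i) 2, pow_mul]
      have hb : |(-1)^(k0+i) * (U^m * V^(m+2))| < U^m * U^(m+2) := by
        have h3 : U^m * U^(m+2) = |U|^m * |U|^(m+2) := by
          rw [← pow_add, ← pow_add, show m + (m+2) = 2*(m+1) by ring, pow_mul, pow_mul, sq_abs]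
        rw [h3, abs_mul, abs_mul, abs_pow, abs_pow, abs_pow]
        simp only [abs_neg, abs_one, one_pow, one_mul]
        have : 0 < |U| := abs_pos.2 hu'
        gcongr
      have := (abs_lt.1 hb).1
      norm_num
      linarith
    exact pos_of_mul_pos_left hq hQ.le
  have htlt : ∀ i j : ℕ, i < j → t i < t j := by
    intro i j hij
    simp only [ht]
    have := Real.pi_pos
    gcongr
  have htle : ∀ i j : ℕ, i ≤ j → t i ≤ t j := by
    intro i j hij
    rcases hij.lt_or_eq with h | rfl
    · exact (htlt i j h).le
    · exact le_rfl
  have hroot : ∀ i : ℕ, ∃ ξ, i + 1 < m / 3 → ξ ∈ Set.Ioo (t i) (t (i+1)) ∧ (H m).eval (Z ξ) = 0 := by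
    intro i
    by_cases hi : i + 1 < m / 3
    swap
    · exact ⟨0, fun h => absurd h hi⟩
    have s1 := hsign i (by omega)
    have s2 := hsign (i+1) hi
    have I1 := hk i (by omega)
    have I2 := hk (i+1) hi
    change t i ∈ _ at I1
    change t (i+1) ∈ _ at I2
    have hsub : Set.Icc (t i) (t (i+1)) ⊆ Set.Ioo α β := fun x hx =>
      ⟨lt_of_lt_of_le I1.1 hx.1, lt_of_le_of_lt hx.2 I2.2⟩
    have hcc := hGc.mono hsub
    rw [← add_assoc, pow_succ] at s2
    have hle := (htlt i (i+1) (by omega)).le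
    have hex : ∃ ξ ∈ Set.Ioo (t i) (t (i+1)), G ξ = 0 := by
      rcases neg_one_pow_eq_or ℝ (k0+i) with h | h
      · rw [h] at s1 s2
        have := intermediate_value_Ioo' hle hcc (show (0:ℝ) ∈ _ from ⟨by linarith, by linarith⟩)
        obtain ⟨ξ, h1, h2⟩ := this
        exact ⟨ξ, h1, h2⟩
      · rw [h] at s1 s2
        have := intermediate_value_Ioo hle hcc (show (0:ℝ) ∈ _ from ⟨by linarith, by linarith⟩)
        obtain ⟨ξ, h1, h2⟩ := this
        exact ⟨ξ, h1, h2⟩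
    obtain ⟨ξ, h1, h2⟩ := hex
    refine ⟨ξ, fun _ => ⟨h1, ?_⟩⟩
    have : u ξ ^ m ≠ 0 := pow_ne_zero _ (hu0 _ (hsub ⟨h1.1.le, h1.2.le⟩))
    exact (mul_eq_zero.1 h2).resolve_right this
  choose ξ hξ using hroot
  have hmem : ∀ i, i + 1 < m/3 → ξ i ∈ Set.Ioo α β := by
    intro i hi
    have I1 := hk i (by omega)
    have I2 := hk (i+1) hi
    change t i ∈ _ at I1
    change t (i+1) ∈ _ at I2
    have := (hξ i hi).1
    exact ⟨I1.1.trans this.1, this.2.trans I2.2⟩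
  have hinjZ : ∀ θ ∈ Set.Ioo α β, ∀ θ' ∈ Set.Ioo α β, Z θ = Z θ' → θ = θ' := by
    intro θ h θ' h' hh
    have a1 := e1 θ h
    have a2 := e2 θ h
    have a1' := e1 θ' h'
    have a2' := e2 θ' h'
    have hs' := hsin _ h'
    have hp' := hsc θ'
    have hu' := hu0 _ h'
    have hpp := hpos θ h θ' h'
    have hun := hu0 _ h
    simp only [hZ] at hh
    have hvv : v θ = v θ' := by
      have f : (v θ - v θ') * ((v θ - u θ' * Real.cos θ')^2 + (u θ' * Real.sin θ')^2) = 0 := by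
        linear_combination (v θ - v θ') * (u θ')^2 * hp' + (v θ)^2 * (a1 - a1') - v θ * (a2 - a2')  - hh
      have : 0 < (u θ' * Real.sin θ')^2 := by positivity
      have h3 : ((v θ - u θ' * Real.cos θ')^2 + (u θ' * Real.sin θ')^2) ≠ 0 := by positivity
      exact sub_eq_zero.1 ((mul_eq_zero.1 f).resolve_right h3)
    rw [hvv] at a1 a2
    have huu : u θ = u θ' := by
      have : (u θ - u θ') * (u θ + u θ') = 0 := by
        linear_combination a2 - a2' - v θ' * (a1 - a1')
      rcases mul_eq_zero.1 this with g | g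
      · linarith
      · have : u θ = - u θ' := by linarith
        rw [this] at hpp
        nlinarith [sq_nonneg (u θ')]
    rw [huu] at a1
    have hcos : Real.cos θ = Real.cos θ' := by
      apply mul_left_cancel₀ hu'
      linarith
    exact Real.injOn_cos ⟨hα.trans h.1.le, h.2.le.trans hβ⟩ ⟨hα.trans h'.1.le, h'.2.le.trans hβ⟩ hcos
  refine all_real (H m) (m/3) hH (deg_bound b c H h0 h1 h2 hrec m)
    ((Finset.range (m/3 - 1)).image (fun i => Z (ξ i))) ?_ ?_ z hz
  · rw [Finset.card_image_of_injOn, Finset.card_range]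
    · omega
    · intro i hi j hj hij
      simp only [Finset.coe_range, Set.mem_Iio] at hi hj
      have := hinjZ _ (hmem i (by omega)) _ (hmem j (by omega)) hij
      have hi' := (hξ i (by omega)).1
      have hj' := (hξ j (by omega)).1
      rcases lt_trichotomy i j with h | h | h
      · have := htle (i+1) j h
        linarith [hi'.2, hj'.1]
      · exact h
      · have := htle (j+1) i h
        linarith [hi'.1, hj'.2]
  · intro r hr
    simp only [Finset.mem_image, Finset.mem_range] at hr
    obtain ⟨i, hi, rfl⟩ := hr
    exact (hξ i (by omega)).2

lemma suff_c0 (b c : ℝ) (H : ℕ → Polynomial ℝ)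
    (h0 : H 0 = 1) (h1 : H 1 = C (-c)) (h2 : H 2 = C (c ^ 2 - b))
    (hrec : ∀ m, H (m + 3) + C c * H (m + 2) + C b * H (m + 1) + X * H m = 0)
    (hc : c = 0) (hb : 0 ≤ b) (m : ℕ) :
    H m = 0 ∨ ∀ z : ℂ, aeval z (H m) = 0 → z.im = 0 := by
  rcases hb.eq_or_lt with hb | hb
  · subst hc; subst hb
    induction m using Nat.strong_induction_on with
    | _ m ih =>
      match m with
      | 0 => right; intro z hz; rw [h0] at hz; simp at hz
      | 1 => left; rw [h1]; simp
      | 2 => left; rw [h2]; simp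
      | j+3 =>
        have : H (j+3) = - (X * H j) := by
          have := hrec j
          simp at this
          linear_combination this
        rw [this]
        rcases ih j (by omega) with h | h
        · left; rw [h]; simp
        · right; intro z hz
          simp at hz
          rcases hz with hz | hz
          · rw [hz]; simp
          · exact h z hz
  · have hpi := Real.pi_pos
    have hcos : ∀ θ ∈ Set.Ioo (Real.pi/3) (2*Real.pi/3), 0 < 1 - 4 * Real.cos θ ^ 2 ∧ |2 * Real.cos θ| < 1 := by
      intro θ h
      have c1 : Real.cos θ < 1/2 := by
        rw [← Real.cos_pi_div_three]
        exact Real.cos_lt_cos_of_nonneg_of_le_pi (by positivity) (by linarith [h.2]) h.1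
      have c2 : -(1/2) < Real.cos θ := by
        rw [← Real.cos_pi_div_three, ← Real.cos_pi_sub]
        exact Real.cos_lt_cos_of_nonneg_of_le_pi (by linarith [h.1]) (by linarith) (by linarith [h.2])
      refine ⟨by nlinarith, abs_lt.2 ⟨by linarith, by linarith⟩⟩
    have hupos : ∀ θ ∈ Set.Ioo (Real.pi/3) (2*Real.pi/3), 0 < Real.sqrt (b / (1 - 4 * Real.cos θ ^ 2)) := by
      intro θ h
      have := (hcos θ h).1
      positivity
    have hcont : ContinuousOn (fun θ => Real.sqrt (b / (1 - 4 * Real.cos θ ^ 2))) (Set.Ioo (Real.pi/3) (2*Real.pi/3)) := by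
      apply ContinuousOn.sqrt
      apply ContinuousOn.div continuousOn_const (by fun_prop)
      intro θ h
      exact (hcos θ h).1.ne'
    refine suff_core b c H h0 h1 h2 hrec m (Real.pi/3) (2*Real.pi/3) (by positivity) (by linarith)
      (fun θ => Real.sqrt (b / (1 - 4 * Real.cos θ ^ 2)))
      (fun θ => - (2 * Real.cos θ * Real.sqrt (b / (1 - 4 * Real.cos θ ^ 2)))) hcont ?_ ?_ ?_ ?_ ?_ (m/3+1) ?_
    · exact ((by fun_prop : ContinuousOn (fun θ => 2 * Real.cos θ) _).mul hcont).neg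
    · intro θ h θ' h'
      exact mul_pos (hupos θ h) (hupos θ' h')
    · intro θ h
      rw [abs_neg, abs_mul]
      have := abs_pos.2 (hupos θ h).ne'
      nlinarith [(hcos θ h).2]
    · intro θ h
      rw [hc]; ring
    · intro θ h
      have hs := Real.sq_sqrt (show 0 ≤ b / (1 - 4 * Real.cos θ ^ 2) from (by have := (hcos θ h).1; positivity))
      have h1' := (hcos θ h).1.ne'
      have : Real.sqrt (b / (1 - 4 * Real.cos θ ^ 2))^2 * (1 - 4 * Real.cos θ ^ 2) = b := by
        rw [hs]; field_simp
      linear_combination this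
    · intro i hi
      have hm2 : (0:ℝ) < m + 2 := by positivity
      have n1 : m + 2 < 3 * (m/3+1+1+i) := by omega
      have n2 : 3 * (m/3+1+1+i) < 2 * (m+2) := by omega
      have r1 : ((m:ℝ) + 2) < 3 * ((m/3+1+1+i : ℕ) : ℝ) := by exact_mod_cast n1
      have r2 : 3 * ((m/3+1+1+i : ℕ) : ℝ) < 2 * ((m:ℝ) + 2) := by exact_mod_cast n2
      constructor
      · rw [div_lt_div_iff₀ (by norm_num) hm2]
        nlinarith
      · rw [div_lt_div_iff₀ hm2 (by norm_num)]
        nlinarith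

lemma suff_c1 (b c : ℝ) (H : ℕ → Polynomial ℝ)
    (h0 : H 0 = 1) (h1 : H 1 = C (-c)) (h2 : H 2 = C (c ^ 2 - b))
    (hrec : ∀ m, H (m + 3) + C c * H (m + 2) + C b * H (m + 1) + X * H m = 0)
    (hc : c ≠ 0) (hb1 : -1 ≤ b / c^2) (hb2 : b/c^2 ≤ 1/3) (m : ℕ) :
    H m = 0 ∨ ∀ z : ℂ, aeval z (H m) = 0 → z.im = 0 := by
  obtain ⟨a, ha⟩ : ∃ a, a = b / c^2 := ⟨_, rfl⟩
  rw [← ha] at hb1 hb2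
  have hba : b = a * c^2 := by rw [ha]; field_simp
  have hpi := Real.pi_pos
  have hcos : ∀ θ ∈ Set.Ioo 0 (Real.pi/3), 1/2 < Real.cos θ ∧ Real.cos θ < 1 := by
    intro θ h
    constructor
    · rw [← Real.cos_pi_div_three]
      exact Real.cos_lt_cos_of_nonneg_of_le_pi h.1.le (by linarith [h.2]) h.2
    · rw [← Real.cos_zero]
      exact Real.cos_lt_cos_of_nonneg_of_le_pi le_rfl (by linarith [h.2]) h.1
  set w : ℝ → ℝ := fun θ => (Real.cos θ + Real.sqrt (Real.cos θ ^ 2 - a * (4 * Real.cos θ ^ 2 - 1))) / (4 * Real.cos θ ^ 2 - 1) with hw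
  have hwc : ContinuousOn w (Set.Ioo 0 (Real.pi/3)) := by
    apply ContinuousOn.div (by fun_prop) (by fun_prop)
    intro θ h
    have := hcos θ h
    nlinarith
  have hwp : ∀ θ ∈ Set.Ioo 0 (Real.pi/3), 0 < w θ ∧ w θ * (2 * Real.cos θ - 1) < 1 ∧ 1 < w θ * (2 * Real.cos θ + 1) ∧
      (4 * Real.cos θ ^ 2 - 1) * w θ ^ 2 - 2 * Real.cos θ * w θ + a = 0 := by
    intro θ h
    obtain ⟨k1, k2⟩ := hcos θ h
    simp only [hw]
    set k := Real.cos θ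
    have hs : 0 < 4 * k^2 - 1 := by nlinarith
    have hD : 0 < k^2 - a * (4*k^2-1) := by nlinarith
    have hsq := Real.sq_sqrt hD.le
    have hr := Real.sqrt_pos.2 hD
    set R := Real.sqrt (k^2 - a * (4*k^2-1))
    have hs' : 4*k^2-1 = (2*k-1)*(2*k+1) := by ring
    have p1 : 0 < 2*k-1 := by linarith
    have p2 : 0 < 2*k+1 := by linarith
    have hR : R < 1 + k := by
      apply lt_of_pow_lt_pow_left₀ 2 (by linarith)
      rw [hsq]
      have : 0 < (1+2*k)*(1+a*(2*k-1)) := by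
        apply mul_pos (by linarith)
        nlinarith
      nlinarith
    refine ⟨by positivity, ?_, ?_, ?_⟩
    · rw [div_mul_eq_mul_div, div_lt_one hs, hs']
      nlinarith
    · rw [div_mul_eq_mul_div, one_lt_div hs, hs']
      nlinarith
    · field_simp
      linear_combination hsq
  have hc2 : 0 < c^2 := by positivity
  refine suff_core b c H h0 h1 h2 hrec m 0 (Real.pi/3) le_rfl (by linarith)
      (fun θ => - c * w θ) (fun θ => c * (2 * Real.cos θ * w θ - 1)) ?_ ?_ ?_ ?_ ?_ ?_ 0 ?_
  · exact continuousOn_const.mul hwc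
  · exact continuousOn_const.mul (((by fun_prop : ContinuousOn (fun θ => 2 * Real.cos θ) _).mul hwc).sub continuousOn_const)
  · intro θ h θ' h'
    have a1 := (hwp θ h).1
    have a2 := (hwp θ' h').1
    have : 0 < c^2 * (w θ * w θ') := by positivity
    linarith
  · intro θ h
    obtain ⟨a1, a2, a3, a4⟩ := hwp θ h
    rw [abs_mul, abs_mul, abs_neg, abs_of_pos a1]
    apply mul_lt_mul_of_pos_left _ (abs_pos.2 hc)
    rw [abs_lt]
    constructor <;> linarith
  · intro θ h
    ring
  · intro θ h
    obtain ⟨a1, a2, a3, a4⟩ := hwp θ h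
    rw [hba]
    linear_combination (-c^2) * a4
  · intro i hi
    have hm2 : (0:ℝ) < m + 2 := by positivity
    have n2 : 3 * (0+1+i) < m+2 := by omega
    have r2 : 3 * ((0+1+i : ℕ) : ℝ) < (m:ℝ) + 2 := by exact_mod_cast n2
    constructor
    · have : (0:ℝ) < ((0+1+i : ℕ) : ℝ) := by exact_mod_cast (by omega)
      positivity
    · rw [div_lt_div_iff₀ hm2 (by norm_num)]
      nlinarith

open Filter Topology in
lemma lower_bd (b c z x y w : ℂ) (E : ℕ → ℂ) (h0 : E 0 = 1) (h1 : E 1 = -c) (h2 : E 2 = c^2-b)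
    (hrec : ∀ m, E (m+3) + c * E (m+2) + b * E (m+1) + z * E m = 0)
    (e1 : x + y + w = -c) (e2 : x*y+x*w+y*w = b) (e3 : x*y*w = -z)
    (hyw : y ≠ w) (hy : ‖y‖ < ‖x‖) (hw : ‖w‖ < ‖x‖) :
    ∃ κ : ℝ, 0 < κ ∧ ∀ᶠ m : ℕ in atTop, κ * ‖x‖^m ≤ ‖E m‖ := by
  have hx0 : 0 < ‖x‖ := lt_of_le_of_lt (norm_nonneg _) hy
  have hx : x ≠ 0 := norm_pos_iff.1 hx0
  have hxy : x ≠ y := by rintro rfl; exact lt_irrefl _ hy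
  have hxw : x ≠ w := by rintro rfl; exact lt_irrefl _ hw
  set V := (x-y)*(x-w)*(y-w) with hV
  have hV0 : V ≠ 0 := mul_ne_zero (mul_ne_zero (sub_ne_zero.2 hxy) (sub_ne_zero.2 hxw)) (sub_ne_zero.2 hyw)
  have key : ∀ m, E m * V = x^(m+2) * ((y-w) - (y/x)^(m+2)*(x-w) + (w/x)^(m+2)*(x-y)) := by
    intro m
    rw [pf_formula b c z x y w E h0 h1 h2 hrec e1 e2 e3 m, div_pow, div_pow]
    field_simp
  have ty : Tendsto (fun m : ℕ => (y/x)^(m+2)) atTop (𝓝 0) :=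
    (tendsto_pow_atTop_nhds_zero_of_norm_lt_one (by rw [norm_div, div_lt_one hx0]; exact hy)).comp (tendsto_add_atTop_nat 2)
  have tw : Tendsto (fun m : ℕ => (w/x)^(m+2)) atTop (𝓝 0) :=
    (tendsto_pow_atTop_nhds_zero_of_norm_lt_one (by rw [norm_div, div_lt_one hx0]; exact hw)).comp (tendsto_add_atTop_nat 2)
  have tt : Tendsto (fun m : ℕ => ‖(y-w) - (y/x)^(m+2)*(x-w) + (w/x)^(m+2)*(x-y)‖) atTop (𝓝 ‖(y-w) - 0*(x-w) + 0*(x-y)‖) :=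
    ((tendsto_const_nhds.sub (ty.mul_const _)).add (tw.mul_const _)).norm
  have hp : 0 < ‖y-w‖ := norm_pos_iff.2 (sub_ne_zero.2 hyw)
  have ev := tt.eventually (lt_mem_nhds (show ‖y-w‖/2 < ‖(y-w) - 0*(x-w) + 0*(x-y)‖ by rw [zero_mul, zero_mul, sub_zero, add_zero]; linarith))
  have hVp : 0 < ‖V‖ := norm_pos_iff.2 hV0
  refine ⟨‖x‖^2 * (‖y-w‖/2) / ‖V‖, by positivity, ?_⟩
  filter_upwards [ev] with m hm
  have k := congrArg norm (key m)
  rw [norm_mul (E m), norm_mul (x^(m+2)), norm_pow] at k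
  rw [div_mul_eq_mul_div, div_le_iff₀ hVp, k, pow_add]
  have : 0 ≤ ‖x‖^m * ‖x‖^2 := by positivity
  nlinarith

lemma upper_bd (b c z x y w : ℂ) (M : ℝ) (E : ℕ → ℂ) (h0 : E 0 = 1) (h1 : E 1 = -c) (h2 : E 2 = c^2-b)
    (hrec : ∀ m, E (m+3) + c * E (m+2) + b * E (m+1) + z * E m = 0)
    (e1 : x + y + w = -c) (e2 : x*y+x*w+y*w = b) (e3 : x*y*w = -z)
    (hxy : x ≠ y) (hxw : x ≠ w) (hyw : y ≠ w) (hx : ‖x‖ ≤ M) (hy : ‖y‖ ≤ M) (hw : ‖w‖ ≤ M) :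
    ∃ K : ℝ, 0 < K ∧ ∀ m : ℕ, ‖E m‖ ≤ K * M^m := by
  set V := (x-y)*(x-w)*(y-w) with hV
  have hV0 : V ≠ 0 := mul_ne_zero (mul_ne_zero (sub_ne_zero.2 hxy) (sub_ne_zero.2 hxw)) (sub_ne_zero.2 hyw)
  have hVp : 0 < ‖V‖ := norm_pos_iff.2 hV0
  have hM : 0 ≤ M := (norm_nonneg _).trans hx
  have hp : 0 ≤ M^2 * (‖y-w‖ + ‖x-w‖ + ‖x-y‖) / ‖V‖ := by positivity
  refine ⟨M^2 * (‖y-w‖ + ‖x-w‖ + ‖x-y‖) / ‖V‖ + 1, by linarith, fun m => ?_⟩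
  have key := congrArg norm (pf_formula b c z x y w E h0 h1 h2 hrec e1 e2 e3 m)
  rw [norm_mul] at key
  have b1 : ‖x^(m+2)*(y-w) - y^(m+2)*(x-w) + w^(m+2)*(x-y)‖ ≤ M^(m+2)*‖y-w‖ + M^(m+2)*‖x-w‖ + M^(m+2)*‖x-y‖ := by
    refine (norm_add_le _ _).trans (add_le_add ((norm_sub_le _ _).trans (add_le_add ?_ ?_)) ?_) <;>
    · rw [norm_mul, norm_pow]
      gcongr
  rw [← key] at b1
  have : ‖E m‖ ≤ (M^2 * (‖y-w‖ + ‖x-w‖ + ‖x-y‖) / ‖V‖) * M^m := by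
    rw [div_mul_eq_mul_div, le_div_iff₀ hVp]
    refine b1.trans (le_of_eq ?_)
    ring
  have h3 : 0 ≤ M^m := by positivity
  linarith

open Filter Topology in
lemma grow (f : ℝ → ℂ) (δ : ℝ) (hδ : 0 < δ) (hf0 : f 0 = 1) (hf : HasDerivAt f (δ : ℂ) 0) :
    ∀ᶠ t : ℝ in 𝓝[>] 0, 1 + δ/2 * t < ‖f t‖ := by
  have hre : HasDerivAt (fun t => (f t).re) δ 0 := by
    have := (Complex.reCLM.hasFDerivAt (x := f 0)).comp_hasDerivAt (0:ℝ) hf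
    simpa [Function.comp_def] using this
  have hs := hre.hasDerivWithinAt (s := Set.Ioi 0)
  rw [hasDerivWithinAt_iff_tendsto_slope' (by simp)] at hs
  have ev := hs.eventually (lt_mem_nhds (show δ/2 < δ by linarith))
  filter_upwards [ev, self_mem_nhdsWithin] with t ht htp
  rw [Set.mem_Ioi] at htp
  rw [slope_def_field, hf0, sub_zero, lt_div_iff₀ htp] at ht
  simp at ht
  have := Complex.re_le_norm (f t)
  linarith

open Filter Topology in
lemma nec_core (b c : ℝ) (H : ℕ → Polynomial ℝ)
    (h0 : H 0 = 1) (h1 : H 1 = C (-c)) (h2 : H 2 = C (c ^ 2 - b))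
    (hrec : ∀ m, H (m + 3) + C c * H (m + 2) + C b * H (m + 1) + X * H m = 0)
    (hyp : ∀ m, H m = 0 ∨ ∀ z : ℂ, aeval z (H m) = 0 → z.im = 0)
    (x y w : ℂ) (e1 : x + y + w = -c) (e2 : x*y+x*w+y*w = b) (him : (x*y*w).im ≠ 0)
    (hxy : ‖x‖ = ‖y‖) (hw : ‖w‖ < ‖x‖) (hne : x ≠ y) (hab : x^2 + y^2 ≠ w*(x+y)) : False := by
  have hx0 : 0 < ‖x‖ := lt_of_le_of_lt (norm_nonneg _) hw
  have hx : x ≠ 0 := norm_pos_iff.1 hx0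
  have hy : y ≠ 0 := norm_pos_iff.1 (hxy ▸ hx0)
  have hxw : x ≠ w := by rintro rfl; exact lt_irrefl _ hw
  have hyw : y ≠ w := by rintro rfl; rw [hxy] at hw; exact lt_irrefl _ hw
  have hd1 : x - y ≠ 0 := sub_ne_zero.2 hne
  have hd1' : y - x ≠ 0 := sub_ne_zero.2 hne.symm
  have hd2 : x - w ≠ 0 := sub_ne_zero.2 hxw
  have hd3 : y - w ≠ 0 := sub_ne_zero.2 hyw
  set z0 : ℂ := -(x*y*w) with hz0
  have hz0im : z0.im ≠ 0 := by rw [hz0, Complex.neg_im]; exact neg_ne_zero.2 him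
  set g : ℂ → ℂ := fun s => -(s^3 + c*s^2 + b*s) with hg
  have hc' : (c:ℂ) = -(x+y+w) := by rw [e1]; ring
  have gx : g x = z0 := by
    simp only [hg, hz0]; rw [hc', ← e2]; ring
  have gy : g y = z0 := by
    simp only [hg, hz0]; rw [hc', ← e2]; ring
  have hgd : ∀ s, HasStrictDerivAt g (-(3*s^2+2*c*s+b)) s := by
    intro s
    have := (((hasStrictDerivAt_id s).pow 3).add (((hasStrictDerivAt_id s).pow 2).const_mul (c:ℂ))).add
      ((hasStrictDerivAt_id s).const_mul (b:ℂ)) |>.neg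
    convert! this using 1
    simp
    ring
  have hgx : HasStrictDerivAt g (-((x-y)*(x-w))) x := by
    convert! hgd x using 1
    rw [hc', ← e2]; ring
  have hgy : HasStrictDerivAt g (-((y-x)*(y-w))) y := by
    convert! hgd y using 1
    rw [hc', ← e2]; ring
  have nx : -((x-y)*(x-w)) ≠ 0 := neg_ne_zero.2 (mul_ne_zero hd1 hd2)
  have ny : -((y-x)*(y-w)) ≠ 0 := neg_ne_zero.2 (mul_ne_zero hd1' hd3)
  obtain ⟨P, hPd, hPr, hPv⟩ : ∃ P : ℂ → ℂ, HasDerivAt P (-((x-y)*(x-w)))⁻¹ z0 ∧ (∀ᶠ s in 𝓝 z0, g (P s) = s) ∧ P z0 = x := by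
    refine ⟨hgx.localInverse _ _ _ nx, ?_, ?_, ?_⟩
    · have := (hgx.to_localInverse nx).hasDerivAt
      rwa [gx] at this
    · have := hgx.eventually_right_inverse nx
      rwa [gx] at this
    · have := (hgx.eventually_left_inverse nx).self_of_nhds
      rwa [gx] at this
  obtain ⟨Q, hQd, hQr, hQv⟩ : ∃ Q : ℂ → ℂ, HasDerivAt Q (-((y-x)*(y-w)))⁻¹ z0 ∧ (∀ᶠ s in 𝓝 z0, g (Q s) = s) ∧ Q z0 = y := by
    refine ⟨hgy.localInverse _ _ _ ny, ?_, ?_, ?_⟩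
    · have := (hgy.to_localInverse ny).hasDerivAt
      rwa [gy] at this
    · have := hgy.eventually_right_inverse ny
      rwa [gy] at this
    · have := (hgy.eventually_left_inverse ny).self_of_nhds
      rwa [gy] at this
  set A := (-((x-y)*(x-w)))⁻¹ with hA
  set B := (-((y-x)*(y-w)))⁻¹ with hB
  obtain ⟨η, hη⟩ : ∃ η, η = A/x - B/y := ⟨_, rfl⟩
  have hη0 : η ≠ 0 := by
    intro h
    rw [hη, hA, hB, sub_eq_zero] at h
    apply hab
    have hh : (-((y-x)*(y-w))) * y = (-((x-y)*(x-w))) * x := by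
      rw [div_eq_div_iff hx hy] at h
      field_simp at h
      first
        | linear_combination h
        | linear_combination -h
        | (have h5 : (x-y) * (y * (y-w) + x * (x-w)) = 0 := by
             first
               | linear_combination h
               | linear_combination (-1:ℂ) * h
               | linear_combination (x-y) * h
           linear_combination h5)
    have h5 : (x-y) * (x^2 + y^2 - w*(x+y)) = 0 := by linear_combination hh
    exact sub_eq_zero.1 ((mul_eq_zero.1 h5).resolve_left hd1)
  set d : ℂ := (starRingEnd ℂ) η with hd
  set δ : ℝ := ‖η‖^2 with hδ
  have hδp : 0 < δ := by have := norm_pos_iff.2 hη0; positivity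
  have hηd : η * d = (δ:ℂ) := by
    rw [hd, Complex.mul_conj, Complex.normSq_eq_norm_sq]
  -- paths
  have pp : HasDerivAt (fun t : ℝ => z0 + t * d) d 0 := by
    have := ((Complex.ofRealCLM.hasDerivAt (x := (0:ℝ))).mul_const d).const_add z0
    simpa using this
  have pm : HasDerivAt (fun t : ℝ => z0 - t * d) (-d) 0 := by
    have := ((Complex.ofRealCLM.hasDerivAt (x := (0:ℝ))).mul_const d).const_sub z0
    simpa using this
  have Pp : HasDerivAt (fun t : ℝ => P (z0 + t * d)) (A * d) 0 :=
    HasDerivAt.comp (0:ℝ) (h₂ := P) (by simpa using hPd) pp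
  have Pm : HasDerivAt (fun t : ℝ => P (z0 - t * d)) (A * (-d)) 0 :=
    HasDerivAt.comp (0:ℝ) (h₂ := P) (by simpa using hPd) pm
  have Qp : HasDerivAt (fun t : ℝ => Q (z0 + t * d)) (B * d) 0 :=
    HasDerivAt.comp (0:ℝ) (h₂ := Q) (by simpa using hQd) pp
  have Qm : HasDerivAt (fun t : ℝ => Q (z0 - t * d)) (B * (-d)) 0 :=
    HasDerivAt.comp (0:ℝ) (h₂ := Q) (by simpa using hQd) pm
  have g1 := grow (fun t : ℝ => P (z0 + t * d) * Q (z0 - t * d) / (x*y)) δ hδp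
    (by simp [hPv, hQv, hx, hy]) (by
      convert! (Pp.mul Qm).div_const (x*y) using 1
      simp [hPv, hQv]
      rw [← hηd, hη]
      field_simp
      ring)
  have g2 := grow (fun t : ℝ => P (z0 + t * d) / Q (z0 + t * d) * (y/x)) δ hδp
    (by simp [hPv, hQv]; field_simp) (by
      convert! (Pp.div Qp (by simp [hQv, hy])).mul_const (y/x) using 1
      simp [hPv, hQv]
      rw [← hηd, hη]
      field_simp)
  have g3 := grow (fun t : ℝ => Q (z0 - t * d) / P (z0 - t * d) * (x/y)) δ hδp
    (by simp [hPv, hQv]; field_simp) (by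
      convert! (Qm.div Pm (by simp [hPv, hx])).mul_const (x/y) using 1
      simp [hPv, hQv]
      rw [← hηd, hη]
      field_simp
      ring)
  -- nearby events
  have cP : ContinuousAt P z0 := hPd.continuousAt
  have cQ : ContinuousAt Q z0 := hQd.continuousAt
  have cW : ContinuousAt (fun s => -(c:ℂ) - P s - Q s) z0 := (continuousAt_const.sub cP).sub cQ
  have hW0 : -(c:ℂ) - P z0 - Q z0 = w := by rw [hPv, hQv, ← e1]; ring
  have evs : ∀ᶠ s in 𝓝 z0, g (P s) = s ∧ g (Q s) = s ∧ P s ≠ Q s ∧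
      ‖-(c:ℂ) - P s - Q s‖ < ‖P s‖ ∧ ‖-(c:ℂ) - P s - Q s‖ < ‖Q s‖ := by
    have v1 : ∀ᶠ s in 𝓝 z0, P s - Q s ≠ 0 :=
      (cP.sub cQ).eventually_ne (show P z0 - Q z0 ≠ 0 by rw [hPv, hQv]; exact hd1)
    have v4 := cW.norm.eventually_lt cP.norm (by rw [hW0, hPv]; exact hw)
    have v5 := cW.norm.eventually_lt cQ.norm (by rw [hW0, hQv, ← hxy]; exact hw)
    filter_upwards [hPr, hQr, v1, v4, v5] with s a1 a2 a3 a4 a5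
    exact ⟨a1, a2, sub_ne_zero.1 a3, a4, a5⟩
  have tp : Tendsto (fun t : ℝ => z0 + t * d) (𝓝[>] 0) (𝓝 z0) := by
    have := pp.continuousAt.tendsto
    simp at this
    exact this.mono_left nhdsWithin_le_nhds
  have tm : Tendsto (fun t : ℝ => z0 - t * d) (𝓝[>] 0) (𝓝 z0) := by
    have := pm.continuousAt.tendsto
    simp at this
    exact this.mono_left nhdsWithin_le_nhds
  have small : ∀ᶠ t : ℝ in 𝓝[>] 0, t * (‖d‖^2/z0.im^2) < δ/2 := by
    have : Tendsto (fun t : ℝ => t * (‖d‖^2/z0.im^2)) (𝓝[>] 0) (𝓝 (0 * (‖d‖^2/z0.im^2))) :=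
      (tendsto_id.mono_left nhdsWithin_le_nhds).mul_const _
    exact this.eventually (gt_mem_nhds (by simp; exact hδp))
  obtain ⟨t, q1, q2, q3, vp, vm, ts, t0⟩ := (g1.and (g2.and (g3.and ((tp.eventually evs).and
    ((tm.eventually evs).and (small.and self_mem_nhdsWithin)))))).exists
  replace t0 : 0 < t := t0
  have hfac : ∀ s, g (P s) = s → g (Q s) = s → P s ≠ Q s →
      P s + Q s + (-(c:ℂ) - P s - Q s) = -c ∧
      P s * Q s + P s * (-(c:ℂ) - P s - Q s) + Q s * (-(c:ℂ) - P s - Q s) = b ∧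
      P s * Q s * (-(c:ℂ) - P s - Q s) = -s := by
    intro s a1 a2 a3
    have hn := sub_ne_zero.2 a3
    simp only [hg] at a1 a2
    have f2 : P s * Q s + P s * (-(c:ℂ) - P s - Q s) + Q s * (-(c:ℂ) - P s - Q s) = b := by
      apply mul_left_cancel₀ hn
      linear_combination a1 - a2
    refine ⟨by ring, f2, ?_⟩
    linear_combination (P s) * f2 - a1
  have hEr : ∀ s : ℂ, ∀ m, aeval s (H (m+3)) + (c:ℂ) * aeval s (H (m+2)) + (b:ℂ) * aeval s (H (m+1)) + s * aeval s (H m) = 0 := by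
    intro s m
    have := congrArg (aeval s) (hrec m)
    simpa using this
  have E0 : ∀ s : ℂ, aeval s (H 0) = 1 := fun s => by rw [h0]; simp
  have E1 : ∀ s : ℂ, aeval s (H 1) = -(c:ℂ) := fun s => by rw [h1]; simp
  have E2 : ∀ s : ℂ, aeval s (H 2) = (c:ℂ)^2 - b := fun s => by rw [h2]; simp
  have hone : 1 < 1 + δ/2 * t := by have : 0 < δ/2 * t := by positivity
                                    linarith
  set zp := z0 + t * d with hzp
  set zm := z0 - t * d with hzm
  obtain ⟨p1, p2, p3, p4, p5⟩ := vp
  obtain ⟨m1, m2, m3, m4, m5⟩ := vm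
  have nPp : 0 < ‖P zp‖ := lt_of_le_of_lt (norm_nonneg _) p4
  have nQp : 0 < ‖Q zp‖ := lt_of_le_of_lt (norm_nonneg _) p5
  have nPm : 0 < ‖P zm‖ := lt_of_le_of_lt (norm_nonneg _) m4
  have nQm : 0 < ‖Q zm‖ := lt_of_le_of_lt (norm_nonneg _) m5
  have hQP : ‖Q zp‖ < ‖P zp‖ := by
    have := hone.trans q2
    rw [norm_mul, norm_div, norm_div, hxy, div_self (by rw [← hxy]; exact hx0.ne'), mul_one, one_lt_div nQp] at this
    exact this
  have hPQ : ‖P zm‖ < ‖Q zm‖ := by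
    have := hone.trans q3
    rw [norm_mul, norm_div, norm_div, hxy, div_self (by rw [← hxy]; exact hx0.ne'), mul_one, one_lt_div nPm] at this
    exact this
  obtain ⟨f1, f2, f3⟩ := hfac zp p1 p2 p3
  obtain ⟨κ1, k1, lp⟩ := lower_bd b c zp (P zp) (Q zp) _ (fun m => aeval zp (H m)) (E0 _) (E1 _) (E2 _) (hEr _)
    f1 f2 f3 (by intro h; rw [← h] at p5; exact lt_irrefl _ p5) hQP p4
  obtain ⟨f1, f2, f3⟩ := hfac zm m1 m2 m3
  obtain ⟨κ2, k2, lm⟩ := lower_bd b c zm (Q zm) (P zm) (-(c:ℂ) - P zm - Q zm) (fun m => aeval zm (H m)) (E0 _) (E1 _) (E2 _) (hEr _)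
    (by linear_combination f1) (by linear_combination f2) (by linear_combination f3)
    (by intro h; rw [← h] at m4; exact lt_irrefl _ m4) hPQ m5
  obtain ⟨K, hK, ub⟩ := upper_bd b c z0 x y w ‖x‖ (fun m => aeval z0 (H m)) (E0 _) (E1 _) (E2 _) (hEr _)
    e1 e2 (by rw [hz0]; ring) hne hxw hyw le_rfl hxy.ge hw.le
  set σ := ‖(t:ℂ) * d‖^2/z0.im^2 with hσ
  have hσ0 : 0 ≤ σ := by positivity
  have hσt : σ < δ/2 * t := by
    rw [hσ, norm_mul, Complex.norm_real, Real.norm_eq_abs, abs_of_pos t0]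
    calc (t * ‖d‖)^2 / z0.im^2 = (t * (‖d‖^2/z0.im^2)) * t := by ring
      _ < δ/2 * t := by gcongr
  set R := ‖P zp‖ * ‖Q zm‖ with hR
  set S := ‖x‖^2 * (1 + σ) with hS
  have hS0 : 0 < S := by positivity
  have hSR : S < R := by
    rw [norm_div, norm_mul, norm_mul, ← hxy, lt_div_iff₀ (by positivity)] at q1
    calc S = (1+σ) * (‖x‖*‖x‖) := by rw [hS]; ring
      _ < (1 + δ/2*t) * (‖x‖*‖x‖) := by gcongr
      _ < R := q1
  have hbound : ∀ᶠ m : ℕ in atTop, (κ1*κ2) * R^m ≤ K^2 * S^m := by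
    filter_upwards [lp, lm] with m l1 l2
    have hd : (H m).natDegree ≤ m := (deg_bound b c H h0 h1 h2 hrec m).trans (Nat.div_le_self _ _)
    have hb := hyp_bound (H m) (hyp m) m hd z0 (t*d) hz0im
    calc (κ1*κ2) * R^m = (κ1 * ‖P zp‖^m) * (κ2 * ‖Q zm‖^m) := by rw [hR, mul_pow]; ring
      _ ≤ ‖aeval zp (H m)‖ * ‖aeval zm (H m)‖ := by gcongr
      _ ≤ ‖aeval z0 (H m)‖^2 * (1+σ)^m := hb
      _ ≤ (K * ‖x‖^m)^2 * (1+σ)^m := by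
        have := ub m
        gcongr
      _ = K^2 * S^m := by rw [hS, mul_pow, mul_pow, ← pow_mul, ← pow_mul]; ring
  have hdiv := tendsto_pow_atTop_atTop_of_one_lt ((one_lt_div hS0).2 hSR)
  have := hdiv.eventually_gt_atTop (K^2/(κ1*κ2))
  obtain ⟨m, a1, a2⟩ := (this.and hbound).exists
  rw [div_pow, div_lt_div_iff₀ (by positivity) (by positivity)] at a1
  linarith

lemma nec_param (b c : ℝ) (H : ℕ → Polynomial ℝ)
    (h0 : H 0 = 1) (h1 : H 1 = C (-c)) (h2 : H 2 = C (c ^ 2 - b))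
    (hrec : ∀ m, H (m + 3) + C c * H (m + 2) + C b * H (m + 1) + X * H m = 0)
    (hyp : ∀ m, H m = 0 ∨ ∀ z : ℂ, aeval z (H m) = 0 → z.im = 0)
    (hc : c ≠ 0) (a s : ℝ) (hb : b = a * c^2) (s1 : -1 < s) (s3 : s < 3)
    (hD : (s+1)/4 < a * s) (hl : 0 < s * (1 - a * s)) : False := by
  have hs0 : s ≠ 0 := by rintro rfl; simp at hl
  obtain ⟨k, hk0, hk⟩ : ∃ k : ℝ, 0 < k ∧ 4 * k^2 = s + 1 := by
    refine ⟨Real.sqrt ((s+1)/4), Real.sqrt_pos.2 (by linarith), ?_⟩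
    rw [Real.sq_sqrt (by linarith)]; ring
  obtain ⟨n, hn0, hn⟩ : ∃ n : ℝ, 0 < n ∧ n^2 = 1 - k^2 := by
    refine ⟨Real.sqrt (1-k^2), Real.sqrt_pos.2 (by linarith), ?_⟩
    rw [Real.sq_sqrt (by linarith)]
  obtain ⟨R, hR0, hR⟩ : ∃ R : ℝ, 0 < R ∧ R^2 = a*s - k^2 := by
    refine ⟨Real.sqrt (a*s-k^2), Real.sqrt_pos.2 (by linarith), ?_⟩
    rw [Real.sq_sqrt (by linarith)]
  obtain ⟨q, hq⟩ : ∃ q : ℂ, q = ⟨-k/s, R/s⟩ := ⟨_, rfl⟩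
  have hqr : q.re = -k/s := by rw [hq]
  have hqi : q.im = R/s := by rw [hq]
  have hqi0 : q.im ≠ 0 := by rw [hqi]; positivity
  have hq0 : q ≠ 0 := by rintro rfl; simp at hqi0
  have hquad : (s:ℂ) * q^2 + 2*k*q + a = 0 := by
    apply Complex.ext
    · simp [pow_two, hqr, hqi]
      field_simp
      linear_combination -hR
    · simp [pow_two, hqr, hqi]
      field_simp
      ring
  have hkC : 4 * (k:ℂ)^2 = s + 1 := by exact_mod_cast congrArg (Complex.ofReal) hk
  have hnC : (n:ℂ)^2 = 1 - k^2 := by exact_mod_cast congrArg (Complex.ofReal) hn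
  have hbC : (b:ℂ) = a * c^2 := by exact_mod_cast congrArg (Complex.ofReal) hb
  have hcC : (c:ℂ) ≠ 0 := by exact_mod_cast hc
  have hnC0 : (n:ℂ) ≠ 0 := by exact_mod_cast hn0.ne'
  have hI := Complex.I_sq
  have nx : ‖(k:ℂ) + n * Complex.I‖ = 1 := by
    rw [← sq_eq_sq₀ (norm_nonneg _) (by norm_num), ← Complex.normSq_eq_norm_sq, Complex.normSq_add_mul_I]
    linarith
  have ny : ‖(k:ℂ) - n * Complex.I‖ = 1 := by
    rw [← sq_eq_sq₀ (norm_nonneg _) (by norm_num), ← Complex.normSq_eq_norm_sq,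
      show (k:ℂ) - n * Complex.I = k + ((-n : ℝ):ℂ) * Complex.I by push_cast; ring, Complex.normSq_add_mul_I]
    linarith
  refine nec_core b c H h0 h1 h2 hrec hyp (c*q*(k+n*Complex.I)) (c*q*(k-n*Complex.I)) (c*(-1-2*k*q)) ?_ ?_ ?_ ?_ ?_ ?_ ?_
  · ring
  · rw [hbC]
    linear_combination (c^2*q^2)*hnC - (c^2*q^2*n^2) * hI - c^2*hquad - c^2*q^2*hkC
  · intro h
    have key : (s:ℂ)^2 * ((c*q*(k+n*Complex.I)) * (c*q*(k-n*Complex.I)) * (c*(-1-2*k*q))) =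
        -c^3 * (2*k*(1-a*s)*q + a) := by
      linear_combination ((s:ℂ)^2 * c^3 * q^2 * (-1-2*k*q)) * (hnC - n^2 * hI) - c^3 * (2*k*s*q-1) * hquad + c^3 * s * q^2 * hkC
    have k2 := congrArg Complex.im key
    rw [show (s:ℂ)^2 = ((s^2:ℝ):ℂ) by push_cast; ring, Complex.im_ofReal_mul, h,
      show -(c:ℂ)^3 * (2*k*(1-a*s)*q + a) = ((-c^3:ℝ):ℂ) * (((2*k*(1-a*s):ℝ):ℂ)*q + (a:ℂ)) by push_cast; ring,
      Complex.im_ofReal_mul, Complex.add_im, Complex.im_ofReal_mul, Complex.ofReal_im] at k2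
    have : 1 - a*s ≠ 0 := by intro h; rw [h] at hl; simp at hl
    have : -c^3 * (2*k*(1-a*s)*q.im+0) ≠ 0 := by
      rw [add_zero]
      exact mul_ne_zero (neg_ne_zero.2 (pow_ne_zero _ hc)) (mul_ne_zero (mul_ne_zero (by positivity) this) hqi0)
    apply this
    rw [← k2]; ring
  · rw [norm_mul, norm_mul _ ((k:ℂ) - _), nx, ny]
  · rw [norm_mul _ ((k:ℂ) + _), nx, mul_one, norm_mul, norm_mul]
    apply mul_lt_mul_of_pos_left _ (norm_pos_iff.2 hcC)
    rw [← sq_lt_sq₀ (norm_nonneg _) (norm_nonneg _), ← Complex.normSq_eq_norm_sq, ← Complex.normSq_eq_norm_sq,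
      Complex.normSq_apply, Complex.normSq_apply]
    simp [hqr, hqi]
    have hs2 : 0 < s^2 := by positivity
    rw [← sub_pos]
    apply pos_of_mul_pos_left (b := s^2) _ hs2.le
    have : ((-k/s*(-k/s)+R/s*(R/s)) - ((-1-2*k*(-k/s))*(-1-2*k*(-k/s)) + 2*k*(R/s)*(2*k*(R/s)))) * s^2 = s * (1-a*s) := by
      field_simp
      linear_combination (1-4*k^2)*hR + (s - a*s)*hk
    first
      | (rw [this]; exact hl)
      | (refine lt_of_lt_of_eq hl (this.symm.trans ?_); ring)
  · intro h
    have : (c:ℂ) * q * n * Complex.I = 0 := by linear_combination h/2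
    simp [hcC, hq0, hnC0] at this
  · intro h
    have h3 : (c:ℂ)^2 * q * (s * q + k) = 0 := by
      linear_combination h/2 - (c^2*q^2)*hkC - c^2*q^2* n^2 * hI + c^2 * q^2 * hnC
    have h4 : (s:ℂ) * q + k = 0 := by
      rcases mul_eq_zero.1 h3 with g | g
      · exact absurd g (mul_ne_zero (pow_ne_zero _ hcC) hq0)
      · exact g
    have := congrArg Complex.im h4
    simp at this
    rcases this with g | g
    · exact hs0 g
    · exact hqi0 g

/-- Zeros of all `H_m` are real (with the convention that the zero polynomial is hyperbolic)
iff (i) `c = 0 ∧ b ≥ 0` or (ii) `c ≠ 0 ∧ -1 ≤ b/c² ≤ 1/3`. -/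
theorem stmt_0 (b c : ℝ) (H : ℕ → Polynomial ℝ)
    (h0 : H 0 = 1) (h1 : H 1 = C (-c)) (h2 : H 2 = C (c ^ 2 - b))
    (hrec : ∀ m, H (m + 3) + C c * H (m + 2) + C b * H (m + 1) + X * H m = 0) :
    (∀ m, H m = 0 ∨ ∀ z : ℂ, aeval z (H m) = 0 → z.im = 0) ↔
      ((c = 0 ∧ 0 ≤ b) ∨ (c ≠ 0 ∧ -1 ≤ b / c ^ 2 ∧ b / c ^ 2 ≤ 1 / 3)) := by
  constructor
  · intro hyp
    by_cases hc : c = 0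
    · left
      refine ⟨hc, ?_⟩
      by_contra hb
      push Not at hb
      subst hc
      have r0 := hrec 0
      have r1 := hrec 1
      have r2 := hrec 2
      have r3 := hrec 3
      norm_num at r0 r1 r2 r3 h1 h2
      have H3 : H 3 = -X := by rw [h0, h1] at r0; linear_combination r0
      have H4 : H 4 = C b * C b := by rw [h1, h2] at r1; linear_combination r1
      have H6 : H 6 = X^2 - C b * C b * C b := by rw [H3, H4] at r3; linear_combination r3
      have hr : 0 < Real.sqrt (-b^3) := Real.sqrt_pos.2 (by
        have : 0 < (-b)^3 := pow_pos (by linarith) 3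
        linarith [this, (by ring : (-b)^3 = -b^3)])
      have hsq := Real.sq_sqrt (Real.sqrt_pos.1 hr).le
      have hz : aeval ((Real.sqrt (-b^3) : ℂ) * Complex.I) (H 6) = 0 := by
        have hsC : ((Real.sqrt (-b^3) : ℝ):ℂ)^2 = -b^3 := by exact_mod_cast congrArg Complex.ofReal hsq
        rw [H6]
        simp only [map_sub, map_mul, map_pow, aeval_X, aeval_C, Complex.coe_algebraMap]
        linear_combination ((Real.sqrt (-b^3) : ℝ):ℂ)^2 * Complex.I_sq - hsC
      rcases hyp 6 with h | h
      · rw [H6] at h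
        have := congrArg (eval (0:ℝ)) h
        simp at this
        linarith
      · have := h _ hz
        simp at this
        rw [this] at hr
        exact lt_irrefl _ hr
    · right
      have hb : b = (b/c^2) * c^2 := by field_simp
      set a := b/c^2 with ha
      refine ⟨hc, ?_, ?_⟩
      · by_contra h
        push Not at h
        have : -1 < 1/a := by
          rw [lt_div_iff_of_neg (by linarith)]; linarith
        obtain ⟨s, l1, l2⟩ := exists_between this
        rw [lt_div_iff_of_neg (by linarith)] at l2
        have hs : s < 0 := by nlinarith
        exact nec_param b c H h0 h1 h2 hrec hyp hc a s hb l1 (by linarith) (by nlinarith) (by nlinarith)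
      · by_contra h
        push Not at h
        have p1 : 0 < 4*a-1 := by linarith
        have p2 : 0 < a := by linarith
        have : 1/(4*a-1) < min (1/a) 3 := by
          rw [lt_min_iff]
          constructor
          · rw [div_lt_div_iff₀ p1 p2]; linarith
          · rw [div_lt_iff₀ p1]; linarith
        obtain ⟨s, l1, l2⟩ := exists_between this
        rw [lt_min_iff, lt_div_iff₀ p2] at l2
        rw [div_lt_iff₀ p1] at l1
        have hs : 0 < s := by
          by_contra hs
          push Not at hs
          nlinarith
        exact nec_param b c H h0 h1 h2 hrec hyp hc a s hb (by linarith) l2.2 (by linarith)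
          (mul_pos hs (by linarith [l2.1]))
  · rintro (⟨hc, hb⟩ | ⟨hc, hb1, hb2⟩) m
    · exact suff_c0 b c H h0 h1 h2 hrec hc hb m
    · exact suff_c1 b c H h0 h1 h2 hrec hc hb1 hb2 m
end

section
/- Let b, c ∈ ℝ with c ≠ 0 and −1 ≤ b/c² ≤ 1/3, and let {H_m(z)} be defined by H_0 = 1, H_1 = −c, H_2 = c² − b, and H_m + c·H_{m−1} + b·H_{m−2} + z·H_{m−3} = 0 for m ≥ 3. Then the union over all m ≥ 0 of the zero sets of H_m is dense in the set { c³·x : x ≤ (−2 + 9b/c² − 2√((1 − 3b/c²)³))/27 }. -/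
open Polynomial

open Filter Topology in
lemma mean_geom (X ζ : ℂ) (h1 : ‖ζ‖ = 1) (h : ζ ≠ 1) :
    Tendsto (fun n : ℕ => (n : ℝ)⁻¹ • ∑ i ∈ Finset.range n, X * ζ ^ i) atTop (𝓝 0) := by
  have hb : ∀ n : ℕ, ‖∑ i ∈ Finset.range n, X * ζ ^ i‖ ≤ ‖X‖ * (2 / ‖ζ - 1‖) := by
    intro n
    rw [← Finset.mul_sum, norm_mul, geom_sum_eq h, norm_div]
    gcongr
    calc ‖ζ ^ n - 1‖ ≤ ‖ζ ^ n‖ + ‖(1 : ℂ)‖ := norm_sub_le _ _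
      _ = 2 := by rw [norm_pow, h1]; norm_num
  have hn : Tendsto (fun n : ℕ => (n : ℝ)⁻¹) atTop (𝓝 0) := tendsto_inv_atTop_nhds_zero_nat
  refine squeeze_zero_norm (a := fun n : ℕ => (n : ℝ)⁻¹ * (‖X‖ * (2 / ‖ζ - 1‖))) ?_ ?_
  · intro n
    rw [norm_smul]
    have : ‖(n : ℝ)⁻¹‖ = (n : ℝ)⁻¹ := by
      rw [Real.norm_eq_abs, abs_of_nonneg]; positivity
    rw [this]
    gcongr
    exact hb n
  · simpa using hn.mul_const (‖X‖ * (2 / ‖ζ - 1‖))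

open Filter Topology in
lemma mean_add {x y : ℕ → ℂ} {L M : ℂ}
    (hx : Tendsto (fun n : ℕ => (n : ℝ)⁻¹ • ∑ i ∈ Finset.range n, x i) atTop (𝓝 L))
    (hy : Tendsto (fun n : ℕ => (n : ℝ)⁻¹ • ∑ i ∈ Finset.range n, y i) atTop (𝓝 M)) :
    Tendsto (fun n : ℕ => (n : ℝ)⁻¹ • ∑ i ∈ Finset.range n, (x i + y i)) atTop (𝓝 (L + M)) := by
  simpa [Finset.sum_add_distrib, smul_add] using hx.add hy

open Filter Topology in
lemma mean_re {x : ℕ → ℝ} {L : ℂ}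
    (hx : Tendsto (fun n : ℕ => (n : ℝ)⁻¹ • ∑ i ∈ Finset.range n, (x i : ℂ)) atTop (𝓝 L)) :
    Tendsto (fun n : ℕ => (n : ℝ)⁻¹ * ∑ i ∈ Finset.range n, x i) atTop (𝓝 L.re) := by
  have := (Complex.continuous_re.tendsto L).comp hx
  refine this.congr fun n => ?_
  simp [Function.comp]

open Filter Topology in
lemma key (a b : ℕ → ℝ) (P P' Q Q' ω η : ℂ) (e f : ℕ → ℂ)
    (ha : ∀ m, (a m : ℂ) = P * ω ^ m + P' * ω⁻¹ ^ m + e m)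
    (hb : ∀ m, (b m : ℂ) = Q * η ^ m + Q' * η⁻¹ ^ m + f m)
    (he : Tendsto e atTop (𝓝 0)) (hf : Tendsto f atTop (𝓝 0))
    (hω : ‖ω‖ = 1) (hη : ‖η‖ = 1) (hω2 : ω ^ 2 ≠ 1) (hη2 : η ^ 2 ≠ 1)
    (h1 : (ω * η) ^ 2 ≠ 1) (h2 : (ω * η⁻¹) ^ 2 ≠ 1)
    (hPQ : 0 < (P * P' * Q * Q').re) (hab : ∀ m, 0 ≤ a m * b m) : False := by
  have ω0 : ω ≠ 0 := by rintro rfl; simp at hω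
  have η0 : η ≠ 0 := by rintro rfl; simp at hη
  have hinv : ∀ z : ℂ, z ≠ 1 → z⁻¹ ≠ 1 := fun z hz h => hz (inv_eq_one.mp h)
  have hsq : ∀ z : ℂ, z ^ 2 ≠ 1 → z ≠ 1 := by rintro z hz rfl; simp at hz
  set u : ℕ → ℂ := fun m => P * ω ^ m + P' * ω⁻¹ ^ m with hu
  set v : ℕ → ℂ := fun m => Q * η ^ m + Q' * η⁻¹ ^ m with hv
  have ub : ∀ m, ‖u m‖ ≤ ‖P‖ + ‖P'‖ := fun m => by
    refine (norm_add_le _ _).trans ?_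
    simp [hω]
  have vb : ∀ m, ‖v m‖ ≤ ‖Q‖ + ‖Q'‖ := fun m => by
    refine (norm_add_le _ _).trans ?_
    simp [hη]
  have null_bdd : ∀ (x y : ℕ → ℂ) (K : ℝ), Tendsto x atTop (𝓝 0) → (∀ m, ‖y m‖ ≤ K) →
      Tendsto (fun m => x m * y m) atTop (𝓝 0) := by
    intro x y K hx hy
    refine squeeze_zero_norm (a := fun m => ‖x m‖ * K) ?_ ?_
    · intro m
      rw [norm_mul]
      exact mul_le_mul_of_nonneg_left (hy m) (norm_nonneg _)
    · simpa using hx.norm.mul_const K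
  set d : ℕ → ℂ := fun m => e m * v m + f m * u m + e m * f m with hd
  have hd0 : Tendsto d atTop (𝓝 0) := by
    have := ((null_bdd e v _ he vb).add (null_bdd f u _ hf ub)).add (he.mul hf)
    simpa using this
  have habd : ∀ m, ((a m * b m : ℝ) : ℂ) = u m * v m + d m := by
    intro m
    push_cast
    rw [ha, hb]
    simp only [hd, hu, hv]
    ring
  have uvb : ∀ m, ‖u m * v m‖ ≤ (‖P‖ + ‖P'‖) * (‖Q‖ + ‖Q'‖) := fun m => by
    rw [norm_mul]
    exact mul_le_mul (ub m) (vb m) (norm_nonneg _) (by positivity)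
  obtain ⟨K0, hK0⟩ := (Metric.isBounded_range_of_tendsto d hd0).exists_norm_le
  have hK : ∀ m, a m * b m ≤ (‖P‖ + ‖P'‖) * (‖Q‖ + ‖Q'‖) + K0 := by
    intro m
    have h3 : ‖((a m * b m : ℝ) : ℂ)‖ ≤ (‖P‖ + ‖P'‖) * (‖Q‖ + ‖Q'‖) + K0 := by
      rw [habd]
      exact (norm_add_le _ _).trans (add_le_add (uvb m) (hK0 _ ⟨m, rfl⟩))
    rw [Complex.norm_real] at h3
    exact (le_abs_self _).trans h3
  set K := (‖P‖ + ‖P'‖) * (‖Q‖ + ‖Q'‖) + K0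
  have nz : ∀ ζ : ℂ, ζ ^ 2 ≠ 1 → ζ⁻¹ ^ 2 ≠ 1 := by
    intro ζ h; rw [inv_pow]; exact hinv _ h
  have h3 : (ω⁻¹ * η) ^ 2 ≠ 1 := by
    have := nz _ h2; rwa [mul_inv, inv_inv] at this
  have h4 : (ω⁻¹ * η⁻¹) ^ 2 ≠ 1 := by
    have := nz _ h1; rwa [mul_inv] at this
  have M1 : Tendsto (fun n : ℕ => (n : ℝ)⁻¹ • ∑ i ∈ Finset.range n, ((a i * b i : ℝ) : ℂ))
      atTop (𝓝 0) := by
    have := mean_add (mean_add (mean_add (mean_add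
      (mean_geom (P * Q) (ω * η) (by simp [hω, hη]) (hsq _ h1))
      (mean_geom (P * Q') (ω * η⁻¹) (by simp [hω, hη]) (hsq _ h2)))
      (mean_geom (P' * Q) (ω⁻¹ * η) (by simp [hω, hη]) (hsq _ h3)))
      (mean_geom (P' * Q') (ω⁻¹ * η⁻¹) (by simp [hω, hη]) (hsq _ h4))) hd0.cesaro_smul
    simp only [add_zero] at this
    refine this.congr fun n => ?_
    congr 1
    refine Finset.sum_congr rfl fun i _ => ?_
    rw [habd]
    simp only [hu, hv, mul_pow]
    ring
  have hd1 : Tendsto (fun m => d m * (2 * (u m * v m) + d m)) atTop (𝓝 0) := by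
    have := ((null_bdd d _ _ hd0 uvb).const_mul 2).add (hd0.mul hd0)
    simp only [mul_zero, add_zero] at this
    refine this.congr fun n => ?_
    ring
  have M2 : Tendsto (fun n : ℕ => (n : ℝ)⁻¹ • ∑ i ∈ Finset.range n, (((a i * b i) ^ 2 : ℝ) : ℂ))
      atTop (𝓝 (4 * (P * P' * Q * Q'))) := by
    have hc : Tendsto (fun _ : ℕ => 4 * (P * P' * Q * Q')) atTop (𝓝 (4 * (P * P' * Q * Q'))) :=
      tendsto_const_nhds
    have := mean_add (mean_add (mean_add (mean_add (mean_add (mean_add (mean_add (mean_add (mean_add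
      (mean_geom (P ^ 2 * Q ^ 2) ((ω * η) ^ 2) (by simp [hω, hη]) h1)
      (mean_geom (P ^ 2 * Q' ^ 2) ((ω * η⁻¹) ^ 2) (by simp [hω, hη]) h2))
      (mean_geom (P' ^ 2 * Q ^ 2) ((ω⁻¹ * η) ^ 2) (by simp [hω, hη]) h3))
      (mean_geom (P' ^ 2 * Q' ^ 2) ((ω⁻¹ * η⁻¹) ^ 2) (by simp [hω, hη]) h4))
      (mean_geom (2 * P ^ 2 * (Q * Q')) (ω ^ 2) (by simp [hω]) hω2))
      (mean_geom (2 * P' ^ 2 * (Q * Q')) (ω⁻¹ ^ 2) (by simp [hω]) (nz _ hω2)))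
      (mean_geom (2 * Q ^ 2 * (P * P')) (η ^ 2) (by simp [hη]) hη2))
      (mean_geom (2 * Q' ^ 2 * (P * P')) (η⁻¹ ^ 2) (by simp [hη]) (nz _ hη2)))
      hc.cesaro_smul) hd1.cesaro_smul
    simp only [add_zero, zero_add] at this
    refine this.congr fun n => ?_
    congr 1
    refine Finset.sum_congr rfl fun i _ => ?_
    rw [Complex.ofReal_pow, habd]
    have e1 : ω ^ i * ω⁻¹ ^ i = 1 := by rw [← mul_pow, mul_inv_cancel₀ ω0, one_pow]
    have e2 : η ^ i * η⁻¹ ^ i = 1 := by rw [← mul_pow, mul_inv_cancel₀ η0, one_pow]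
    simp only [hu, hv, mul_pow, ← pow_mul, mul_comm 2 i]
    simp only [pow_mul]
    generalize d i = D
    generalize ω ^ i = A at *
    generalize ω⁻¹ ^ i = A' at *
    generalize η ^ i = B at *
    generalize η⁻¹ ^ i = B' at *
    have q1 : (P * A + P' * A') ^ 2 = P ^ 2 * A ^ 2 + P' ^ 2 * A' ^ 2 + 2 * (P * P') := by
      linear_combination (2 * (P * P')) * e1
    have q2 : (Q * B + Q' * B') ^ 2 = Q ^ 2 * B ^ 2 + Q' ^ 2 * B' ^ 2 + 2 * (Q * Q') := by
      linear_combination (2 * (Q * Q')) * e2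
    have q3 : ((P * A + P' * A') * (Q * B + Q' * B') + D) ^ 2 =
      (P * A + P' * A') ^ 2 * (Q * B + Q' * B') ^ 2
        + D * (2 * ((P * A + P' * A') * (Q * B + Q' * B')) + D) := by ring
    rw [q3, q1, q2]
    ring
  have R1 := (mean_re M1).const_mul K
  have R2 := mean_re M2
  have := le_of_tendsto_of_tendsto' R2 R1 (fun n => by
    have hn0 : (0 : ℝ) ≤ (n : ℝ)⁻¹ := by positivity
    rw [mul_left_comm, Finset.mul_sum (Finset.range n) (fun i => a i * b i) K]
    refine mul_le_mul_of_nonneg_left (Finset.sum_le_sum fun i _ => ?_) hn0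
    rw [sq]
    exact mul_le_mul_of_nonneg_right (hK i) (hab i))
  have h5 : (4 * (P * P' * Q * Q')).re = 4 * (P * P' * Q * Q').re := by
    simp
  rw [h5] at this
  simp at this
  simp at hPQ
  linarith

/-- closed form -/
lemma closed_form (g : ℕ → ℝ) (a x l : ℝ) (α β : ℂ) (h0 : g 0 = 1) (h1 : g 1 = -1)
    (h2 : g 2 = 1 - a) (hrec : ∀ m, g (m + 3) + g (m + 2) + a * g (m + 1) + x * g m = 0)
    (s1 : α + β + l = -1) (s2 : α * β + (α + β) * l = a) (s3 : α * β * l = -x)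
    (d1 : α ≠ β) (d2 : α ≠ l) (d3 : β ≠ l) (m : ℕ) :
    (g m : ℂ) = α ^ 2 / ((α - β) * (α - l)) * α ^ m + β ^ 2 / ((β - α) * (β - l)) * β ^ m
      + (l : ℂ) ^ 2 / ((l - α) * (l - β)) * (l : ℂ) ^ m := by
  have n1 : α - β ≠ 0 := sub_ne_zero.mpr d1
  have n2 : α - l ≠ 0 := sub_ne_zero.mpr d2
  have n3 : β - l ≠ 0 := sub_ne_zero.mpr d3
  have n1' : β - α ≠ 0 := sub_ne_zero.mpr d1.symm
  have n2' : (l : ℂ) - α ≠ 0 := sub_ne_zero.mpr d2.symm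
  have n3' : (l : ℂ) - β ≠ 0 := sub_ne_zero.mpr d3.symm
  have t1 : β - α = -(α - β) := by ring
  have t2 : (l : ℂ) - α = -(α - l) := by ring
  have t3 : (l : ℂ) - β = -(β - l) := by ring
  have key : ∀ r : ℂ, (r - α) * (r - β) * (r - l) = r ^ 3 + r ^ 2 + a * r + x := by
    intro r
    linear_combination (-r ^ 2) * s1 + r * s2 - s3
  have ka := key α
  have kb := key β
  have kl := key l
  simp only [sub_self, zero_mul, mul_zero] at ka kb kl
  induction m using Nat.strong_induction_on with
  | _ m ih =>
    match m with
    | 0 =>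
      rw [h0, t1, t2, t3]; push_cast; field_simp; ring
    | 1 =>
      have : ((g 1 : ℝ) : ℂ) = α + β + l := by rw [h1, s1]; simp
      rw [this, t1, t2, t3]; field_simp; ring
    | 2 =>
      have : ((g 2 : ℝ) : ℂ) = (α + β + l) ^ 2 - (α * β + (α + β) * l) := by
        rw [h2, s1, s2]; push_cast; ring
      rw [this, t1, t2, t3]; field_simp; ring
    | k + 3 =>
      have hr : (g (k + 3) : ℂ) = -(g (k + 2) + a * g (k + 1) + x * g k) := by
        have := hrec k
        have h : g (k + 3) = -(g (k + 2) + a * g (k + 1) + x * g k) := by linarith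
        rw [h]; push_cast; ring
      rw [hr, ih (k + 2) (by omega), ih (k + 1) (by omega), ih k (by omega)]
      generalize α ^ 2 / ((α - β) * (α - l)) = A
      generalize β ^ 2 / ((β - α) * (β - l)) = B
      generalize (l : ℂ) ^ 2 / ((l - α) * (l - β)) = L
      linear_combination (A * α ^ k) * ka + (B * β ^ k) * kb + (L * (l : ℂ) ^ k) * kl

open Filter Topology in
lemma asym (g : ℕ → ℝ) (a x l : ℝ) (h0 : g 0 = 1) (h1 : g 1 = -1)
    (h2 : g 2 = 1 - a) (hrec : ∀ m, g (m + 3) + g (m + 2) + a * g (m + 1) + x * g m = 0)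
    (hx : x = -(l ^ 3 + l ^ 2 + a * l)) (hd : 0 < 3 * l ^ 2 + 2 * l + 4 * a - 1)
    (hl : 0 < l + a) :
    ∃ (r : ℝ) (P P' ω : ℂ) (e : ℕ → ℂ) (p : ℝ), 0 < r ∧
      (∀ m, ((g m / r ^ m : ℝ) : ℂ) = P * ω ^ m + P' * ω⁻¹ ^ m + e m) ∧
      Tendsto e atTop (𝓝 0) ∧ ‖ω‖ = 1 ∧ ω ^ 2 ≠ 1 ∧ 0 < p ∧ P * P' = (p : ℂ) ∧
      ω.re ^ 2 * (4 * (l ^ 2 + l + a)) = (1 + l) ^ 2 := by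
  obtain ⟨y, hy0, hy⟩ : ∃ y : ℝ, 0 < y ∧ 4 * y ^ 2 = 3 * l ^ 2 + 2 * l + 4 * a - 1 := by
    refine ⟨√(3 * l ^ 2 + 2 * l + 4 * a - 1) / 2, by positivity, ?_⟩
    rw [div_pow, Real.sq_sqrt hd.le]; ring
  have hr2 : 0 < l ^ 2 + l + a := by nlinarith [sq_nonneg l]
  obtain ⟨r, hr0, hr⟩ : ∃ r : ℝ, 0 < r ∧ r ^ 2 = l ^ 2 + l + a :=
    ⟨√(l ^ 2 + l + a), by positivity, Real.sq_sqrt hr2.le⟩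
  set α : ℂ := ⟨-(1 + l) / 2, y⟩ with hα
  set β : ℂ := (starRingEnd ℂ) α with hβ
  have s1 : α + β + l = -1 := by
    apply Complex.ext <;> simp [hα, hβ]
  have hαβ : α * β = ((r ^ 2 : ℝ) : ℂ) := by
    rw [hβ, Complex.mul_conj, Complex.normSq_apply]
    congr 1
    simp only [hα]; nlinarith
  have hab1 : α + β = ((-1 - l : ℝ) : ℂ) := by
    push_cast; linear_combination s1
  have s2 : α * β + (α + β) * l = a := by
    rw [hαβ, hab1, hr]; push_cast; ring
  have s3 : α * β * l = -x := by
    rw [hαβ, hr, hx]; push_cast; ring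
  have him : α.im = y := rfl
  have d1 : α ≠ β := by
    intro h; have := congrArg Complex.im h; simp [hβ, him] at this; linarith
  have d2 : α ≠ l := by
    intro h; have := congrArg Complex.im h; simp [him] at this; linarith
  have d3 : β ≠ l := by
    intro h; have := congrArg Complex.im h; simp [hβ, him] at this; linarith
  have hα0 : α ≠ 0 := by
    intro h; have := congrArg Complex.im h; simp [him] at this; linarith
  have hrc : (r : ℂ) ≠ 0 := by exact_mod_cast hr0.ne'
  have hinv : (α / r)⁻¹ = β / r := by
    rw [inv_div, div_eq_div_iff hα0 hrc, mul_comm β, hαβ]; push_cast; ring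
  have cf := closed_form g a x l α β h0 h1 h2 hrec s1 s2 s3 d1 d2 d3
  have hnorm : ‖α‖ = r := by
    have : ‖α‖ ^ 2 = r ^ 2 := by
      rw [← Complex.normSq_eq_norm_sq, Complex.normSq_apply]
      simp only [hα]; nlinarith
    exact (sq_eq_sq₀ (norm_nonneg _) hr0.le).mp this
  refine ⟨r, α ^ 2 / ((α - β) * (α - l)), β ^ 2 / ((β - α) * (β - l)), α / r,
    fun m => (l : ℂ) ^ 2 / ((l - α) * (l - β)) * ((l : ℂ) / r) ^ m,
    Complex.normSq (α ^ 2 / ((α - β) * (α - l))), hr0, ?_, ?_, ?_, ?_, ?_, ?_, ?_⟩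
  · intro m
    rw [hinv]
    push_cast
    rw [cf m]
    simp only [div_pow]
    ring
  · have : Tendsto (fun m : ℕ => ((l : ℂ) / r) ^ m) atTop (𝓝 0) := by
      apply tendsto_pow_atTop_nhds_zero_of_norm_lt_one
      rw [norm_div, Complex.norm_real, Complex.norm_real, Real.norm_eq_abs, Real.norm_eq_abs,
        abs_of_pos hr0, div_lt_one hr0]
      exact abs_lt_of_sq_lt_sq (by linarith) hr0.le
    simpa using this.const_mul ((l : ℂ) ^ 2 / ((l - α) * (l - β)))
  · rw [norm_div, hnorm, Complex.norm_real, Real.norm_eq_abs, abs_of_pos hr0, div_self hr0.ne']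
  · intro h
    have : α / r = β / r := by
      rw [← hinv]; rw [sq] at h; exact eq_inv_of_mul_eq_one_left h
    exact d1 (by field_simp at this; exact this)
  · rw [Complex.normSq_pos]
    exact div_ne_zero (pow_ne_zero _ hα0)
      (mul_ne_zero (sub_ne_zero.mpr d1) (sub_ne_zero.mpr d2))
  · rw [← Complex.mul_conj]
    congr 1
    simp [hβ]
  · rw [Complex.div_ofReal_re, ← hr]
    simp only [hα]
    field_simp
    norm_num

lemma re_sq {ω η : ℂ} (hω : ‖ω‖ = 1) (h : (ω * η) ^ 2 = 1) : ω.re ^ 2 = η.re ^ 2 := by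
  have h0 : ω ≠ 0 := by rintro rfl; simp at hω
  have hn : Complex.normSq ω = 1 := by rw [Complex.normSq_eq_norm_sq, hω]; norm_num
  rcases mul_eq_zero.mp (show (ω * η - 1) * (ω * η + 1) = 0 by linear_combination h) with h | h
  · replace h := sub_eq_zero.mp h
    have : η = ω⁻¹ := eq_inv_of_mul_eq_one_right h
    rw [this, Complex.inv_re, hn]; simp
  · replace h := eq_neg_of_add_eq_zero_left h
    have : -η = ω⁻¹ := eq_inv_of_mul_eq_one_right (by rw [mul_neg, h]; simp)
    have h2 : η = -ω⁻¹ := by rw [← this]; simp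
    rw [h2, Complex.neg_re, Complex.inv_re, hn]; simp

lemma two_points (g g' : ℕ → ℝ) (a l l' : ℝ) (ha : a ≤ 1 / 3)
    (h0 : g 0 = 1) (h1 : g 1 = -1) (h2 : g 2 = 1 - a)
    (hrec : ∀ m, g (m + 3) + g (m + 2) + a * g (m + 1) + -(l ^ 3 + l ^ 2 + a * l) * g m = 0)
    (h0' : g' 0 = 1) (h1' : g' 1 = -1) (h2' : g' 2 = 1 - a)
    (hrec' : ∀ m, g' (m + 3) + g' (m + 2) + a * g' (m + 1)
      + -(l' ^ 3 + l' ^ 2 + a * l') * g' m = 0)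
    (hd : 0 < 3 * l ^ 2 + 2 * l + 4 * a - 1) (hl : 0 < l + a)
    (hd' : 0 < 3 * l' ^ 2 + 2 * l' + 4 * a - 1) (hl' : 0 < l' + a) (hll : l ≠ l')
    (hpos : ∀ m, 0 ≤ g m * g' m) : False := by
  obtain ⟨r, P, P', ω, e, p, hr, hg, he, hω, hω2, hp, hPP, hre⟩ :=
    asym g a _ l h0 h1 h2 hrec rfl hd hl
  obtain ⟨s, Q, Q', η, f, q, hs, hg', hf, hη, hη2, hq, hQQ, hre'⟩ :=
    asym g' a _ l' h0' h1' h2' hrec' rfl hd' hl'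
  have hne : ω.re ^ 2 ≠ η.re ^ 2 := by
    intro h
    rw [h] at hre
    have h3 : (1 + l) ^ 2 * (l' ^ 2 + l' + a) = (1 + l') ^ 2 * (l ^ 2 + l + a) := by
      rw [← hre, ← hre']; ring
    have h4 : (l' - l) * ((1 + l) * (1 + l') - a * ((1 + l) + (1 + l'))) = 0 := by
      linear_combination h3
    rcases mul_eq_zero.mp h4 with h5 | h5
    · exact hll (by linarith)
    · have u1 : 0 < 1 + l := by linarith
      have u2 : 0 < 1 + l' := by linarith
      have v1 : 0 < 1 + l - 2 * a := by linarith
      have v2 : 0 < 1 + l' - 2 * a := by linarith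
      nlinarith [mul_pos u1 v2, mul_pos u2 v1]
  refine key (fun m => g m / r ^ m) (fun m => g' m / s ^ m) P P' Q Q' ω η e f hg hg' he hf hω hη
    hω2 hη2 (fun h => hne (re_sq hω h)) (fun h => hne ?_) ?_ ?_
  · rw [re_sq hω h, Complex.inv_re, Complex.normSq_eq_norm_sq, hη]; simp
  · have : P * P' * Q * Q' = ((p * q : ℝ) : ℂ) := by
      rw [hPP, mul_assoc, hQQ]; push_cast; ring
    rw [this, Complex.ofReal_re]; positivity
  · intro m
    have : g m / r ^ m * (g' m / s ^ m) = g m * g' m / (r ^ m * s ^ m) := by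
      rw [div_mul_div_comm]
    rw [this]
    have := hpos m
    positivity

lemma dense_one (a : ℝ) (ha1 : -1 ≤ a) (ha2 : a ≤ 1 / 3) (G : ℕ → ℝ → ℝ)
    (hcont : ∀ m, Continuous (G m))
    (h0 : ∀ x, G 0 x = 1) (h1 : ∀ x, G 1 x = -1) (h2 : ∀ x, G 2 x = 1 - a)
    (hrec : ∀ x m, G (m + 3) x + G (m + 2) x + a * G (m + 1) x + x * G m x = 0)
    (x : ℝ) (hx : x ≤ (-2 + 9 * a - 2 * Real.sqrt ((1 - 3 * a) ^ 3)) / 27) :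
    x ∈ closure (⋃ m : ℕ, {x : ℝ | G m x = 0}) := by
  obtain ⟨s, hs0, hs⟩ : ∃ s : ℝ, 0 ≤ s ∧ s ^ 2 = 1 - 3 * a :=
    ⟨√(1 - 3 * a), Real.sqrt_nonneg _, Real.sq_sqrt (by linarith)⟩
  have hs3 : Real.sqrt ((1 - 3 * a) ^ 3) = s ^ 3 := by
    rw [← hs, ← pow_mul, mul_comm 2 3, pow_mul, Real.sqrt_sq (by positivity)]
  have hs2 : s ≤ 2 := by nlinarith
  have ha : a = (1 - s ^ 2) / 3 := by linarith
  rw [hs3] at hx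
  set F : ℝ → ℝ := fun l => -(l ^ 3 + l ^ 2 + a * l) with hF
  have hFc : Continuous F := by fun_prop
  set l0 := (2 * s - 1) / 3 with hl0
  have hF0 : F l0 = (-2 + 9 * a - 2 * s ^ 3) / 27 := by
    simp only [hF, hl0, ha]; ring
  obtain ⟨l, hl, hlx⟩ : ∃ l, l0 ≤ l ∧ F l = x := by
    set N := |x| + 2 + l0 with hN
    have hNl : l0 ≤ N := by have := abs_nonneg x; linarith
    have hl0' : -1 / 3 ≤ l0 := by rw [hl0]; linarith
    have hFN : F N ≤ x := by
      simp only [hF]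
      have hN1 : 1 + |x| ≤ N := by linarith
      have := neg_abs_le x
      have h3 : N ≤ N ^ 3 + N ^ 2 + a * N := by
        have hx0 := abs_nonneg x
        have : 1 ≤ N := by linarith
        nlinarith [mul_nonneg (by linarith : 0 ≤ N) (by linarith : 0 ≤ N - 1), pow_pos (by linarith : 0 < N) 3, mul_nonneg (sq_nonneg N) (by linarith : 0 ≤ N - 1), mul_nonneg (by linarith : 0 ≤ 1 + a) (by linarith : 0 ≤ N)]
      linarith
    have := intermediate_value_Icc' hNl hFc.continuousOn ⟨hFN, by rw [hF0]; exact hx⟩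
    obtain ⟨l, hl, h⟩ := this
    exact ⟨l, hl.1, h⟩
  rw [Metric.mem_closure_iff]
  intro ε hε
  by_contra hcon
  push Not at hcon
  have hnz : ∀ m, ∀ y ∈ Metric.ball x ε, G m y ≠ 0 := by
    intro m y hy h
    have := hcon y (Set.mem_iUnion.mpr ⟨m, h⟩)
    rw [Metric.mem_ball, dist_comm] at hy
    linarith
  obtain ⟨δ, hδ, hball⟩ := Metric.continuous_iff.mp hFc l ε hε
  have c1 : ∀ t, l < t → 0 < 3 * t ^ 2 + 2 * t + 4 * a - 1 := by
    intro t ht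
    have h3 : 2 * s < 3 * t + 1 := by linarith
    have h4 : 3 * (3 * t ^ 2 + 2 * t + 4 * a - 1) = (3 * t + 1 - 2 * s) * (3 * t + 1 + 2 * s) := by
      rw [ha]; ring
    have : 0 < (3 * t + 1 - 2 * s) * (3 * t + 1 + 2 * s) :=
      mul_pos (by linarith) (by linarith)
    linarith
  have c2 : ∀ t, l < t → 0 < t + a := by
    intro t ht
    have := mul_nonneg hs0 (by linarith : 0 ≤ 2 - s)
    rw [ha]
    nlinarith
  have m1 : F (l + δ / 2) ∈ Metric.ball x ε := by
    rw [← hlx]; apply hball; rw [Real.dist_eq, add_sub_cancel_left, abs_of_pos] <;> linarith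
  have m2 : F (l + δ / 3) ∈ Metric.ball x ε := by
    rw [← hlx]; apply hball; rw [Real.dist_eq, add_sub_cancel_left, abs_of_pos] <;> linarith
  refine two_points (fun m => G m (F (l + δ / 2))) (fun m => G m (F (l + δ / 3))) a
    (l + δ / 2) (l + δ / 3) ha2 (h0 _) (h1 _) (h2 _) (hrec _) (h0 _) (h1 _) (h2 _) (hrec _)
    (c1 _ (by linarith)) (c2 _ (by linarith)) (c1 _ (by linarith)) (c2 _ (by linarith))
    (fun h => by linarith) ?_
  intro m
  by_contra hneg
  push Not at hneg
  have hpre : IsPreconnected (Metric.ball x ε) := (convex_ball x ε).isPreconnected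
  have hiv : (0 : ℝ) ∈ G m '' Metric.ball x ε := by
    rcases mul_neg_iff.mp hneg with ⟨p1, p2⟩ | ⟨p1, p2⟩
    · exact hpre.intermediate_value m2 m1 (hcont m).continuousOn ⟨p2.le, p1.le⟩
    · exact hpre.intermediate_value m1 m2 (hcont m).continuousOn ⟨p1.le, p2.le⟩
  obtain ⟨y, hy, h⟩ := hiv
  exact hnz m y hy h

/-- If `c ≠ 0` and `-1 ≤ b/c² ≤ 1/3`, the union of the zero sets of the `H_m` is dense
in the set `{c³·x : x ≤ (-2 + 9b/c² - 2√((1 - 3b/c²)³))/27}`. -/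
theorem stmt_1 (b c : ℝ) (hc : c ≠ 0) (hb1 : -1 ≤ b / c ^ 2) (hb2 : b / c ^ 2 ≤ 1 / 3)
    (H : ℕ → Polynomial ℝ)
    (h0 : H 0 = 1) (h1 : H 1 = C (-c)) (h2 : H 2 = C (c ^ 2 - b))
    (hrec : ∀ m, H (m + 3) + C c * H (m + 2) + C b * H (m + 1) + X * H m = 0) :
    {y : ℝ | ∃ x : ℝ,
        x ≤ (-2 + 9 * (b / c ^ 2) - 2 * Real.sqrt ((1 - 3 * (b / c ^ 2)) ^ 3)) / 27 ∧
        y = c ^ 3 * x}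
      ⊆ closure (⋃ m : ℕ, {x : ℝ | (H m).eval x = 0}) := by
  rintro _ ⟨x, hx, rfl⟩
  have hmem := dense_one (b / c ^ 2) hb1 hb2 (fun m x => (H m).eval (c ^ 3 * x) / c ^ m)
    (fun m => by
      have : Continuous fun x : ℝ => (H m).eval (c ^ 3 * x) :=
        (H m).continuous.comp (continuous_const.mul continuous_id)
      exact this.div_const _)
    (by intro x; simp [h0]) (by intro x; simp [h1, hc, neg_div])
    (by intro x; simp [h2]; field_simp)
    (by
      intro x m
      have := congrArg (Polynomial.eval (c ^ 3 * x)) (hrec m)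
      simp only [eval_add, eval_mul, eval_C, eval_X, eval_zero] at this
      have e : (H (m + 3)).eval (c ^ 3 * x) = -(c * (H (m + 2)).eval (c ^ 3 * x)
        + b * (H (m + 1)).eval (c ^ 3 * x) + c ^ 3 * x * (H m).eval (c ^ 3 * x)) := by linarith
      rw [e]
      field_simp
      ring) x hx
  have hcont : Continuous fun x : ℝ => c ^ 3 * x := continuous_const.mul continuous_id
  refine closure_mono ?_ (image_closure_subset_closure_image hcont ⟨x, hmem, rfl⟩)
  rintro _ ⟨y, hy, rfl⟩
  obtain ⟨m, hm⟩ := Set.mem_iUnion.mp hy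
  refine Set.mem_iUnion.mpr ⟨m, ?_⟩
  have hm' : (H m).eval (c ^ 3 * y) / c ^ m = 0 := hm
  rcases div_eq_zero_iff.mp hm' with h | h
  · exact h
  · exact absurd h (pow_ne_zero _ hc)
end

section
/- Let a ∈ ℝ with −1 ≤ a ≤ 1/3, and let {H_m(z)} be the sequence of polynomials defined by H_0 = 1, H_1 = −1, H_2 = 1 − a, and H_{m+3}(z) + H_{m+2}(z) + a·H_{m+1}(z) + z·H_m(z) = 0 for m ≥ 0. Then for every m, all zeros of H_m(z) lie in the real interval I_a = (−∞, (−2 + 9a − 2√((1 − 3a)³))/27]. -/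
open Polynomial

noncomputable def zt (a c : ℝ) : ℝ :=
  (4*a*c^2-1)/(c*(1-2*a)+Real.sqrt (c^2*(1-4*a)+a))

lemma zt_den_pos (a c : ℝ) (ha2 : a ≤ 1/3) (hc1 : 1/2 ≤ c) :
    0 < c*(1-2*a)+Real.sqrt (c^2*(1-4*a)+a) := by
  have := Real.sqrt_nonneg (c^2*(1-4*a)+a)
  have : 0 < c*(1-2*a) := mul_pos (by linarith) (by linarith)
  linarith

lemma zt_facts (a c : ℝ) (ha1 : -1 ≤ a) (ha2 : a ≤ 1/3) (hc1 : 1/2 ≤ c) (hc2 : c ≤ 1) :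
    a*(2*c+zt a c)^2 = 1+2*c*zt a c ∧ zt a c ≤ c ∧ -1 ≤ zt a c := by
  have hden := zt_den_pos a c ha2 hc1
  have hD : 0 ≤ c^2*(1-4*a)+a := by
    nlinarith [mul_nonneg (by linarith : (0:ℝ) ≤ 1/3 - a) (by nlinarith : (0:ℝ) ≤ 4*c^2-1)]
  have hQ := Real.sqrt_nonneg (c^2*(1-4*a)+a)
  have hQ2 := Real.sq_sqrt hD
  have hz : zt a c * (c*(1-2*a)+Real.sqrt (c^2*(1-4*a)+a)) = 4*a*c^2-1 := by
    unfold zt; exact div_mul_cancel₀ _ hden.ne'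
  generalize Real.sqrt (c^2*(1-4*a)+a) = Q at *
  generalize zt a c = w at *
  refine ⟨?_, ?_, ?_⟩
  · have h : (c*(1-2*a)+Q)^2 * (a*(2*c+w)^2 - (1+2*c*w)) = 0 := by
      have e1 : (c*(1-2*a)+Q)^2 * (a*(2*c+w)^2 - (1+2*c*w)) =
        a * (w*(c*(1-2*a)+Q))^2 - 2*c*(1-2*a)*(w*(c*(1-2*a)+Q))*(c*(1-2*a)+Q)
          + (4*a*c^2-1)*(c*(1-2*a)+Q)^2 := by ring
      rw [e1, hz]
      linear_combination (4*a*c^2-1) * hQ2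
    have := (mul_eq_zero.1 h).resolve_left (by positivity)
    linarith
  · by_contra h
    push Not at h
    have h3 : c * (c*(1-2*a)+Q) < 4*a*c^2-1 := by
      rw [← hz]; exact mul_lt_mul_of_pos_right h hden
    nlinarith [mul_nonneg (by linarith : (0:ℝ) ≤ c) hQ,
      mul_nonneg (by linarith : (0:ℝ) ≤ 1/3 - a) (sq_nonneg c)]
  · by_contra h
    push Not at h
    have h3 : 4*a*c^2-1 < -1 * (c*(1-2*a)+Q) := by
      rw [← hz]; exact mul_lt_mul_of_pos_right h hden
    have he : 0 < 1 - 4*a*c^2 := by linarith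
    have hR : Q < (1 - 4*a*c^2) - c*(1-2*a) := by linarith
    have hk : 0 ≤ 1 + a*(2*c-1) := by nlinarith
    have h5 := mul_nonneg he.le (mul_nonneg (by linarith : (0:ℝ) ≤ 2*c-1) hk)
    nlinarith

/-- oscillating function -/
noncomputable def FF (m : ℕ) (w θ : ℝ) : ℝ :=
  w^(m+2) * Real.sin θ + Real.sin ((m+1)*θ) - w * Real.sin ((m+2)*θ)

lemma FF_rec (m : ℕ) (w θ : ℝ) :
    FF (m+3) w θ = (2*Real.cos θ+w) * FF (m+2) w θ
      - (1+2*Real.cos θ*w) * FF (m+1) w θ + w * FF m w θ := by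
  have key : ∀ x : ℝ, Real.sin ((x+2)*θ) =
      2*Real.cos θ * Real.sin ((x+1)*θ) - Real.sin (x*θ) := by
    intro x
    have e1 : (x+2)*θ = (x+1)*θ + θ := by ring
    have e2 : x*θ = (x+1)*θ - θ := by ring
    rw [e1, e2, Real.sin_add, Real.sin_sub]; ring
  have k1 := key (m+1)
  have k2 := key (m+2)
  have k3 := key (m+3)
  unfold FF
  push_cast
  ring_nf at k1 k2 k3 ⊢
  rw [k3, k2, k1]
  ring

lemma H_eval (a r w θ : ℝ) (H : ℕ → Polynomial ℝ)
    (h0 : H 0 = 1) (h1 : H 1 = C (-1)) (h2 : H 2 = C (1 - a))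
    (hrec : ∀ m, H (m + 3) + H (m + 2) + C a * H (m + 1) + X * H m = 0)
    (hr1 : r*(2*Real.cos θ+w) = 1) (hr2 : r^2*(1+2*Real.cos θ*w) = a) (m : ℕ) :
    (H m).eval (r^3*w) * (Real.sin θ * (1-2*Real.cos θ*w+w^2)) = (-r)^m * FF m w θ := by
  have hF0 : FF 0 w θ = Real.sin θ * (1-2*Real.cos θ*w+w^2) := by
    unfold FF; simp [Real.sin_two_mul]; ring
  have hs := Real.sin_sq_add_cos_sq θ
  have e3 : Real.sin (3*θ) = Real.sin θ * (4*Real.cos θ^2-1) := by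
    rw [Real.sin_three_mul]
    linear_combination (-4*Real.sin θ)*hs
  have e4 : Real.sin (4*θ) = Real.sin θ * (8*Real.cos θ^3-4*Real.cos θ) := by
    rw [show (4:ℝ)*θ = 2*(2*θ) by ring, Real.sin_two_mul, Real.sin_two_mul, Real.cos_two_mul]
    ring
  have hF1 : FF 1 w θ = (2*Real.cos θ+w) * (Real.sin θ * (1-2*Real.cos θ*w+w^2)) := by
    unfold FF
    norm_num
    rw [e3, Real.sin_two_mul]; ring
  have hF2 : FF 2 w θ = ((2*Real.cos θ+w)^2 - (1+2*Real.cos θ*w)) *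
      (Real.sin θ * (1-2*Real.cos θ*w+w^2)) := by
    unfold FF
    norm_num
    rw [e3, e4]; ring
  induction m using Nat.strong_induction_on with
  | _ m ih =>
    match m, ih with
    | 0, _ => simp [h0, hF0]
    | 1, _ =>
      rw [h1, hF1]; simp
      linear_combination -(Real.sin θ * (1-2*Real.cos θ*w+w^2)) * hr1
    | 2, _ =>
      rw [h2, hF2]; simp only [eval_C]
      linear_combination (Real.sin θ * (1-2*Real.cos θ*w+w^2)) *
        (hr2 - (r*(2*Real.cos θ+w)+1)*hr1)
    | n+3, ih =>
      have i0 := ih n (by omega)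
      have i1 := ih (n+1) (by omega)
      have i2 := ih (n+2) (by omega)
      have hh := congrArg (eval (r^3*w)) (hrec n)
      simp only [eval_add, eval_mul, eval_C, eval_X, eval_zero] at hh
      rw [FF_rec]
      have hh' : eval (r^3*w) (H (n+3)) = -eval (r^3*w) (H (n+2)) - a * eval (r^3*w) (H (n+1))
        - r^3*w*eval (r^3*w) (H n) := by linarith
      rw [hh']
      have p1 : (-r)^(n+1) = (-r)^n * (-r) := pow_succ _ _
      have p2 : (-r)^(n+2) = (-r)^n * r^2 := by ring
      have p3 : (-r)^(n+3) = (-r)^n * (-r^3) := by ring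
      rw [p1] at i1
      rw [p2] at i2
      rw [p3]
      linear_combination -i2 - a*i1 - r^3*w*i0 + (-r)^n*r^2*FF (n+2) w θ*hr1
        - (-r)^n*r*FF (n+1) w θ * hr2

lemma z_bound (a r w c : ℝ) (ha2 : a ≤ 1/3) (hr : 0 < r) (hc : c ≤ 1) (hc0 : 0 ≤ c) (hw : w ≤ c)
    (hr1 : r*(2*c+w) = 1) (hr2 : r^2*(1+2*c*w) = a) :
    r^3*w ≤ (-2 + 9 * a - 2 * Real.sqrt ((1 - 3 * a) ^ 3)) / 27 := by
  have hS0 := Real.sqrt_nonneg (1-3*a)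
  have hS2 := Real.sq_sqrt (by linarith : 0 ≤ 1-3*a)
  have hS3 : Real.sqrt ((1 - 3 * a) ^ 3) = Real.sqrt (1-3*a)^3 := by
    rw [Real.sqrt_eq_iff_mul_self_eq (pow_nonneg (by linarith) 3) (by positivity)]
    rw [show ((1-3*a)^3 : ℝ) = (Real.sqrt (1-3*a)^2)^3 by rw [hS2]]; ring
  rw [hS3]
  generalize Real.sqrt (1-3*a) = S at *
  have h1 : 0 ≤ (1+S)/3 - r*w := by nlinarith
  have h2 : 0 ≤ ((1+S)/3 - r*c)^2 + r^2*(1-c^2) :=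
    add_nonneg (sq_nonneg _) (mul_nonneg (sq_nonneg _) (by nlinarith))
  have h3 := mul_nonneg h2 h1
  have h4 : (((1+S)/3 - r*c)^2 + r^2*(1-c^2)) * ((1+S)/3 - r*w)
     = ((1+S)/3)^3 - (r*(2*c+w))*((1+S)/3)^2 + (r^2*(1+2*c*w))*((1+S)/3) - r^3*w := by ring
  rw [h4, hr1, hr2] at h3
  have h5 : ((1+S)/3)^3 - 1*((1+S)/3)^2 + a*((1+S)/3) = (-2 + 9 * a - 2 * S^3) / 27 := by
    have : a = (1 - S^2)/3 := by linarith
    rw [this]; ring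
  linarith

lemma z_inj (a r w c r' w' c' : ℝ) (hr : 0 < r) (hr' : 0 < r') (hc : c^2 < 1)
    (hr1 : r*(2*c+w) = 1) (hr2 : r^2*(1+2*c*w) = a)
    (hr1' : r'*(2*c'+w') = 1) (hr2' : r'^2*(1+2*c'*w') = a) (h : r^3*w = r'^3*w') : c = c' := by
  have h1 : ((r'*w' - r*c)^2 + r^2*(1-c^2)) * (r'*w' - r*w) = 0 := by
    linear_combination (-(r'*w')^2)*(hr1 - hr1') + (r'*w')*(hr2-hr2') - h
  have hpos : 0 < (r'*w' - r*c)^2 + r^2*(1-c^2) :=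
    add_pos_of_nonneg_of_pos (sq_nonneg _) (mul_pos (by positivity) (by linarith))
  have h2 : r'*w' = r*w := by
    have := (mul_eq_zero.1 h1).resolve_left hpos.ne'
    linarith
  have h3 : r'*c' = r*c := by linarith
  have h4 : r'^2 = r^2 := by
    have e1 : r^2*(1+2*c*w) = r^2 + 2*(r*c)*(r*w) := by ring
    have e2 : r'^2*(1+2*c'*w') = r'^2 + 2*(r'*c')*(r'*w') := by ring
    rw [e1] at hr2
    rw [e2, h3, h2] at hr2'
    linarith
  have h5 : r' = r := by
    rwa [sq_eq_sq₀ hr'.le hr.le] at h4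
  rw [h5] at h3
  exact (mul_left_cancel₀ hr.ne' h3).symm

lemma small_term (m : ℕ) (a w θ : ℝ) (ha2 : a ≤ 1/3) (hθ0 : 0 < θ) (hθ1 : θ ≤ Real.pi/3)
    (h1 : a*(2*Real.cos θ+w)^2 = 1+2*Real.cos θ*w) (hwc : w ≤ Real.cos θ) (hw1 : -1 ≤ w) :
    |w^(m+2) * Real.sin θ| < (1-w)*Real.cos (θ/2) := by
  have hpi := Real.pi_pos
  have hx0 : 0 < Real.sin (θ/2) := Real.sin_pos_of_pos_of_lt_pi (by linarith) (by linarith)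
  have hx1 : Real.sin (θ/2) ≤ 1/2 := by
    rw [← Real.sin_pi_div_six]
    exact Real.sin_le_sin_of_le_of_le_pi_div_two (by linarith) (by linarith) (by linarith)
  have hy0 : 0 < Real.cos (θ/2) := Real.cos_pos_of_mem_Ioo ⟨by linarith, by linarith⟩
  have hxy := Real.sin_sq_add_cos_sq (θ/2)
  have hs : Real.sin θ = 2*Real.sin (θ/2)*Real.cos (θ/2) := by
    rw [← Real.sin_two_mul]; congr 1; ring
  have hc : Real.cos θ = 1 - 2*Real.sin (θ/2)^2 := by
    rw [show θ = 2*(θ/2) by ring, Real.cos_two_mul]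
    rw [show 2*(θ/2)/2 = θ/2 by ring]
    linarith
  have hsc := Real.sin_sq_add_cos_sq θ
  have h3 : 3*Real.sin θ^2 ≤ (Real.cos θ - w)^2 := by
    nlinarith [mul_nonneg (by linarith : (0:ℝ) ≤ 1/3 - a) (sq_nonneg (2*Real.cos θ+w))]
  have hw2 : |w| ≤ 1 := abs_le.2 ⟨hw1, hwc.trans (Real.cos_le_one _)⟩
  have hp : |w|^(m+2) ≤ |w| := pow_le_of_le_one (abs_nonneg _) hw2 (by omega)
  rw [hs] at h3
  rw [hc] at h3 hwc
  rw [hs, abs_mul, abs_pow, abs_of_pos (by positivity : 0 < 2*Real.sin (θ/2)*Real.cos (θ/2))]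
  generalize Real.sin (θ/2) = x at *
  generalize Real.cos (θ/2) = y at *
  have goal2 : |w| * (2*x) < 1 - w := by
    rcases le_or_gt w 0 with h | h
    · rw [abs_of_nonpos h]; nlinarith
    · rw [abs_of_pos h]
      have hy : 0.8 ≤ y := by nlinarith
      have h4 : 3*x*y ≤ 1-2*x^2-w := by
        have hxy0 : 0 ≤ 3*x*y := by positivity
        refine (sq_le_sq₀ hxy0 (by linarith)).1 ?_
        nlinarith [sq_nonneg (x*y)]
      nlinarith
  calc |w|^(m+2) * (2*x*y) ≤ |w| * (2*x*y) := by gcongr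
    _ = (|w| * (2*x)) * y := by ring
    _ < (1-w)*y := mul_lt_mul_of_pos_right goal2 hy0

lemma FF_sign (m k : ℕ) (w θ : ℝ) (hθ : (2*m+3)*θ = (2*k+1)*Real.pi)
    (h : |w^(m+2) * Real.sin θ| < (1-w)*Real.cos (θ/2)) : 0 < (-1)^k * FF m w θ := by
  have e1 : Real.sin ((m+1)*θ) = (-1)^k * Real.cos (θ/2) := by
    rw [show ((m:ℝ)+1)*θ = (Real.pi/2 - θ/2) + k*Real.pi by linarith, Real.sin_add_nat_mul_pi,
      Real.sin_pi_div_two_sub]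
  have e2 : Real.sin ((m+2)*θ) = (-1)^k * Real.cos (θ/2) := by
    rw [show ((m:ℝ)+2)*θ = (θ/2 + Real.pi/2) + k*Real.pi by linarith, Real.sin_add_nat_mul_pi,
      Real.sin_add_pi_div_two]
  unfold FF
  rw [e1, e2]
  obtain ⟨l1, l2⟩ := abs_lt.1 h
  rcases neg_one_pow_eq_or ℝ k with hk | hk <;> rw [hk] <;> linarith

lemma H_deg (a : ℝ) (H : ℕ → Polynomial ℝ)
    (h0 : H 0 = 1) (h1 : H 1 = C (-1)) (h2 : H 2 = C (1 - a))
    (hrec : ∀ m, H (m + 3) + H (m + 2) + C a * H (m + 1) + X * H m = 0) (m : ℕ) :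
    (H m).natDegree ≤ m/3 := by
  induction m using Nat.strong_induction_on with
  | _ m ih =>
    match m, ih with
    | 0, _ => simp [h0]
    | 1, _ => rw [h1, natDegree_C]
    | 2, _ => rw [h2, natDegree_C]
    | n+3, ih =>
      have i0 := ih n (by omega)
      have i1 := ih (n+1) (by omega)
      have i2 := ih (n+2) (by omega)
      have e : H (n+3) = -(H (n+2) + C a * H (n+1) + X * H n) := by
        linear_combination hrec n
      rw [e, natDegree_neg]
      refine natDegree_add_le_of_degree_le (natDegree_add_le_of_degree_le ?_ ?_) ?_
      · omega
      · exact (natDegree_C_mul_le _ _).trans (by omega)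
      · refine natDegree_mul_le.trans ?_
        rw [natDegree_X]; omega

/-- If `-1 ≤ a ≤ 1/3`, then for every `m` all zeros of `H_m` lie in the real interval
`I_a = (-∞, (-2 + 9a - 2√((1 - 3a)³))/27]`. -/
theorem stmt_3 (a : ℝ) (ha1 : -1 ≤ a) (ha2 : a ≤ 1 / 3) (H : ℕ → Polynomial ℝ)
    (h0 : H 0 = 1) (h1 : H 1 = C (-1)) (h2 : H 2 = C (1 - a))
    (hrec : ∀ m, H (m + 3) + H (m + 2) + C a * H (m + 1) + X * H m = 0) :
    ∀ m, ∀ z : ℂ, aeval z (H m) = 0 →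
      z.im = 0 ∧ z.re ≤ (-2 + 9 * a - 2 * Real.sqrt ((1 - 3 * a) ^ 3)) / 27 := by
  intro m z hz
  rcases Nat.eq_zero_or_pos m with rfl | hm
  · simp [h0] at hz
  have hpi := Real.pi_pos
  -- facts on the open/closed interval
  have hcos : ∀ θ, 0 ≤ θ → θ ≤ Real.pi/3 → 1/2 ≤ Real.cos θ := by
    intro θ h0 h1
    rw [← Real.cos_pi_div_three]
    exact Real.cos_le_cos_of_nonneg_of_le_pi h0 (by linarith) h1
  have hcos' : ∀ θ, 0 ≤ θ → θ < Real.pi/3 → 1/2 < Real.cos θ := by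
    intro θ h0 h1
    rw [← Real.cos_pi_div_three]
    exact Real.cos_lt_cos_of_nonneg_of_le_pi h0 (by linarith) h1
  let W : ℝ → ℝ := fun θ => zt a (Real.cos θ)
  let R : ℝ → ℝ := fun θ => 1/(2*Real.cos θ + W θ)
  have hW : ∀ θ, 0 ≤ θ → θ ≤ Real.pi/3 → a*(2*Real.cos θ+W θ)^2 = 1+2*Real.cos θ*W θ ∧
      W θ ≤ Real.cos θ ∧ -1 ≤ W θ := fun θ h0 h1 =>
    zt_facts a _ ha1 ha2 (hcos θ h0 h1) (Real.cos_le_one _)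
  have hR : ∀ θ, 0 ≤ θ → θ < Real.pi/3 → 0 < R θ ∧ R θ*(2*Real.cos θ+W θ) = 1 ∧
      R θ^2*(1+2*Real.cos θ*W θ) = a := by
    intro θ h0 h1
    obtain ⟨q1, q2, q3⟩ := hW θ h0 h1.le
    have q4 := hcos' θ h0 h1
    have q5 : 0 < 2*Real.cos θ + W θ := by linarith
    have q6 : R θ*(2*Real.cos θ+W θ) = 1 := by
      simp only [R]; field_simp
    refine ⟨by simp only [R]; positivity, q6, ?_⟩
    rw [← q1]
    calc R θ^2*(a*(2*Real.cos θ+W θ)^2) = a*(R θ*(2*Real.cos θ+W θ))^2 := by ring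
      _ = a := by rw [q6]; ring
  have hcont : ContinuousOn (fun θ => FF m (W θ) θ) (Set.Icc 0 (Real.pi/3)) := by
    have hWc : ContinuousOn W (Set.Icc 0 (Real.pi/3)) := by
      simp only [W, zt]
      apply ContinuousOn.div
      · fun_prop
      · fun_prop
      · intro θ hθ
        exact (zt_den_pos a _ ha2 (hcos θ hθ.1 hθ.2)).ne'
    unfold FF
    fun_prop
  let T : ℕ → ℝ := fun k => (2*k+1)*Real.pi/(2*m+3)
  have hmpos : (0:ℝ) < 2*m+3 := by positivity
  have hT : ∀ k, (2*(m:ℝ)+3)*T k = (2*k+1)*Real.pi := by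
    intro k; simp only [T]; field_simp
  have hT0 : ∀ k, 0 < T k := by intro k; simp only [T]; positivity
  have hTmono : StrictMono T := by
    intro i j hij
    have : (i:ℝ) < j := by exact_mod_cast hij
    simp only [T]; gcongr
  have hT1 : ∀ k, k ≤ m/3 → T k ≤ Real.pi/3 := by
    intro k hk
    have : 3*k ≤ m := by omega
    have : 3*(k:ℝ) ≤ m := by exact_mod_cast this
    simp only [T]
    rw [div_le_div_iff₀ hmpos (by norm_num)]
    nlinarith
  have hT00 : T 0 < Real.pi/3 := by
    have : (1:ℝ) ≤ m := by exact_mod_cast hm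
    simp only [T]
    rw [div_lt_div_iff₀ hmpos (by norm_num)]
    push_cast
    nlinarith
  have hsign : ∀ k, k ≤ m/3 → 0 < (-1)^k * FF m (W (T k)) (T k) := by
    intro k hk
    obtain ⟨q1, q2, q3⟩ := hW (T k) (hT0 k).le (hT1 k hk)
    exact FF_sign m k _ _ (hT k) (small_term m a _ _ ha2 (hT0 k) (hT1 k hk) q1 q2 q3)
  have hne : H m ≠ 0 := by
    intro hH
    obtain ⟨_, r1, r2⟩ := hR (T 0) (hT0 0).le hT00
    have := H_eval a _ _ _ H h0 h1 h2 hrec r1 r2 m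
    rw [hH, eval_zero, zero_mul] at this
    have s := hsign 0 (by omega)
    rw [pow_zero, one_mul] at s
    have hr := (hR (T 0) (hT0 0).le hT00).1
    have h3 := (mul_eq_zero.1 this.symm).resolve_left (pow_ne_zero _ (by linarith))
    linarith
  have hzero : ∀ k, ∃ t, k < m/3 → T k < t ∧ t < T (k+1) ∧ FF m (W t) t = 0 := by
    intro k
    by_cases hk : k < m/3
    · have s1 := hsign k hk.le
      have s2 := hsign (k+1) hk
      have hlt : T k < T (k+1) := hTmono (by omega)
      have hc : ContinuousOn (fun θ => (-1)^k * FF m (W θ) θ) (Set.Icc (T k) (T (k+1))) :=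
        continuousOn_const.mul (hcont.mono (Set.Icc_subset_Icc (hT0 k).le (hT1 _ hk)))
      have s3 : (-1)^k * FF m (W (T (k+1))) (T (k+1)) < 0 := by
        rw [pow_succ] at s2; linarith
      obtain ⟨t, ht, ht2⟩ := intermediate_value_Ioo' hlt.le hc ⟨s3, s1⟩
      refine ⟨t, fun _ => ⟨ht.1, ht.2, ?_⟩⟩
      exact (mul_eq_zero.1 ht2).resolve_left (pow_ne_zero _ (by norm_num))
    · exact ⟨0, fun h => absurd h hk⟩
  choose t ht using hzero
  have htI : ∀ k, k < m/3 → 0 < t k ∧ t k < Real.pi/3 := fun k hk =>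
    ⟨(hT0 k).trans (ht k hk).1, (ht k hk).2.1.trans_le (hT1 _ hk)⟩
  let Z : ℕ → ℝ := fun k => R (t k)^3 * W (t k)
  have hZroot : ∀ k, k < m/3 → (H m).eval (Z k) = 0 := by
    intro k hk
    obtain ⟨i1, i2⟩ := htI k hk
    obtain ⟨r0, r1, r2⟩ := hR (t k) i1.le i2
    have := H_eval a _ _ _ H h0 h1 h2 hrec r1 r2 m
    rw [(ht k hk).2.2, mul_zero] at this
    have hs : 0 < Real.sin (t k) := Real.sin_pos_of_pos_of_lt_pi i1 (by linarith)
    have hsc := Real.sin_sq_add_cos_sq (t k)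
    have hp : 0 < 1-2*Real.cos (t k)*W (t k)+W (t k)^2 := by
      nlinarith [sq_nonneg (W (t k) - Real.cos (t k)), pow_pos hs 2]
    exact (mul_eq_zero.1 this).resolve_right (mul_pos hs hp).ne'
  have hZb : ∀ k, k < m/3 → Z k ≤ (-2 + 9 * a - 2 * Real.sqrt ((1 - 3 * a) ^ 3)) / 27 := by
    intro k hk
    obtain ⟨i1, i2⟩ := htI k hk
    obtain ⟨r0, r1, r2⟩ := hR (t k) i1.le i2
    obtain ⟨q1, q2, q3⟩ := hW (t k) i1.le i2.le
    have := hcos _ i1.le i2.le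
    exact z_bound a _ _ _ ha2 r0 (Real.cos_le_one _) (by linarith) q2 r1 r2
  have htlt : ∀ i j, i < j → j < m/3 → t i < t j := by
    intro i j hij hj
    exact ((ht i (hij.trans hj)).2.1.trans_le (hTmono.monotone hij)).trans (ht j hj).1
  have hZinj : ∀ i, i < m/3 → ∀ j, j < m/3 → Z i = Z j → i = j := by
    intro i hi j hj hij
    obtain ⟨i1, i2⟩ := htI i hi
    obtain ⟨r0, r1, r2⟩ := hR (t i) i1.le i2
    obtain ⟨j1, j2⟩ := htI j hj
    obtain ⟨s0, s1, s2⟩ := hR (t j) j1.le j2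
    have hs : 0 < Real.sin (t i) := Real.sin_pos_of_pos_of_lt_pi i1 (by linarith)
    have hsc := Real.sin_sq_add_cos_sq (t i)
    have hc := z_inj a _ _ _ _ _ _ r0 s0 (by nlinarith [pow_pos hs 2]) r1 r2 s1 s2 hij
    have htt : t i = t j := Real.injOn_cos ⟨i1.le, by linarith⟩ ⟨j1.le, by linarith⟩ hc
    rcases lt_trichotomy i j with h | h | h
    · exact absurd htt (htlt i j h hj).ne
    · exact h
    · exact absurd htt (htlt j i h hi).ne'
  by_cases hmem : ∃ k, k < m/3 ∧ z = (Z k : ℂ)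
  · obtain ⟨k, hk, rfl⟩ := hmem
    exact ⟨Complex.ofReal_im _, by rw [Complex.ofReal_re]; exact hZb k hk⟩
  · exfalso
    let S : Finset ℂ := (Finset.range (m/3)).image (fun k => (Z k : ℂ))
    have hzS : z ∉ S := by
      intro h
      obtain ⟨k, hk, he⟩ := Finset.mem_image.1 h
      exact hmem ⟨k, Finset.mem_range.1 hk, he.symm⟩
    have hcard : S.card = m/3 := by
      rw [Finset.card_image_of_injOn, Finset.card_range]
      intro i hi j hj hij
      exact hZinj i (by simpa using hi) j (by simpa using hj) (Complex.ofReal_injective hij)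
    have hmap : (H m).map (algebraMap ℝ ℂ) = 0 := by
      apply eq_zero_of_natDegree_lt_card_of_eval_eq_zero' _ (insert z S)
      · intro i hi
        rcases Finset.mem_insert.1 hi with rfl | hi
        · rw [eval_map_algebraMap]; exact hz
        · obtain ⟨k, hk, rfl⟩ := Finset.mem_image.1 hi
          have := hZroot k (Finset.mem_range.1 hk)
          rw [show ((Z k : ℝ) : ℂ) = algebraMap ℝ ℂ (Z k) from rfl, eval_map_apply, this, map_zero]
      · rw [Finset.card_insert_of_notMem hzS, hcard, natDegree_map]
        have := H_deg a H h0 h1 h2 hrec m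
        omega
    exact hne ((Polynomial.map_eq_zero _).1 hmap)
end

section
/- Let a ∈ ℝ with −1 ≤ a ≤ 1/3, and let {H_m(z)} be the sequence of polynomials defined by H_0 = 1, H_1 = −1, H_2 = 1 − a, and H_{m+3}(z) + H_{m+2}(z) + a·H_{m+1}(z) + z·H_m(z) = 0 for m ≥ 0. Then the union over all m ≥ 0 of the zero sets of H_m is dense in the interval I_a = (−∞, (−2 + 9a − 2√((1 − 3a)³))/27]. -/
open Polynomial

lemma aux_cubic (a ρ x y : ℝ) (hx : x = -(1 + ρ) / 2)
    (hy : x ^ 2 + y ^ 2 = ρ ^ 2 + ρ + a) :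
    (⟨x, y⟩ : ℂ) ^ 3 = -(⟨x, y⟩ : ℂ) ^ 2 - (a : ℂ) * ⟨x, y⟩ - ((-(ρ ^ 3 + ρ ^ 2 + a * ρ) : ℝ) : ℂ) := by
  have hρ : ρ = -1 - 2 * x := by linarith
  have hya : a = x ^ 2 + y ^ 2 - ρ ^ 2 - ρ := by linarith
  subst hya
  subst hρ
  apply Complex.ext
  · simp [pow_succ]; ring
  · simp [pow_succ]; ring

lemma aux_formula (a : ℝ) (H : ℕ → Polynomial ℝ)
    (h0 : H 0 = 1) (h1 : H 1 = C (-1)) (h2 : H 2 = C (1 - a))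
    (hrec : ∀ m, H (m + 3) + H (m + 2) + C a * H (m + 1) + X * H m = 0)
    (ρ x y : ℝ) (hx : x = -(1 + ρ) / 2)
    (hy : x ^ 2 + y ^ 2 = ρ ^ 2 + ρ + a) (m : ℕ) :
    y * ((x - ρ) ^ 2 + y ^ 2) * (H m).eval (-(ρ ^ 3 + ρ ^ 2 + a * ρ)) =
      ((⟨x, y⟩ : ℂ) ^ (m + 2) * ⟨x - ρ, -y⟩).im + y * ρ ^ (m + 2) := by
  have hc := aux_cubic a ρ x y hx hy
  have key : ∀ m : ℕ, ∀ k < 3,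
    y * ((x - ρ) ^ 2 + y ^ 2) * (H (m + k)).eval (-(ρ ^ 3 + ρ ^ 2 + a * ρ)) =
      ((⟨x, y⟩ : ℂ) ^ (m + k + 2) * ⟨x - ρ, -y⟩).im + y * ρ ^ (m + k + 2) := by
    intro m
    induction m with
    | zero =>
      have hρ : ρ = -1 - 2 * x := by linarith
      have hya : a = x ^ 2 + y ^ 2 - ρ ^ 2 - ρ := by linarith
      intro k hk
      interval_cases k
      · simp only [h0, Nat.zero_add]
        simp [pow_succ]; rw [hρ]; ring
      · simp only [h1, Nat.zero_add]
        simp [pow_succ]; rw [hρ]; ring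
      · simp only [h2, Nat.zero_add]
        simp [pow_succ]; rw [hya, hρ]; ring
    | succ m ih =>
      intro k hk
      rcases Nat.lt_or_ge k 2 with h | h
      · have := ih (k + 1) (by omega)
        rw [show m + 1 + k = m + (k + 1) by omega]
        exact this
      · obtain rfl : k = 2 := by omega
        have e0 := ih 0 (by omega)
        have e1 := ih 1 (by omega)
        have e2 := ih 2 (by omega)
        have hr := congrArg (Polynomial.eval (-(ρ ^ 3 + ρ ^ 2 + a * ρ))) (hrec m)
        simp only [eval_add, eval_mul, eval_C, eval_X, eval_zero] at hr
        rw [show m + 1 + 2 = m + 3 by omega]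
        have hp : (⟨x, y⟩ : ℂ) ^ (m + 3 + 2) * ⟨x - ρ, -y⟩ =
            -((⟨x, y⟩ : ℂ) ^ (m + 2 + 2) * ⟨x - ρ, -y⟩)
            - (a : ℂ) * ((⟨x, y⟩ : ℂ) ^ (m + 1 + 2) * ⟨x - ρ, -y⟩)
            - ((-(ρ ^ 3 + ρ ^ 2 + a * ρ) : ℝ) : ℂ) * ((⟨x, y⟩ : ℂ) ^ (m + 0 + 2) * ⟨x - ρ, -y⟩) := by
          have : (⟨x, y⟩ : ℂ) ^ (m + 3 + 2) = (⟨x, y⟩ : ℂ) ^ (m + 2) * (⟨x, y⟩ : ℂ) ^ 3 := by ring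
          rw [this, hc]; ring
        rw [hp, Complex.sub_im, Complex.sub_im, Complex.neg_im, Complex.im_ofReal_mul,
          Complex.im_ofReal_mul]
        rw [Nat.add_zero] at e0 ⊢
        linear_combination (y * ((x - ρ) ^ 2 + y ^ 2)) * hr - e2 - a * e1
          + (ρ ^ 3 + ρ ^ 2 + a * ρ) * e0
  exact key m 0 (by omega)

lemma aux_polar (α β : ℂ) (n : ℕ) :
    (α ^ n * (starRingEnd ℂ) β).im = ‖α‖ ^ n * ‖β‖ * Real.sin (n * α.arg - β.arg) := by
  have h1 : α ^ n * (starRingEnd ℂ) β =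
      ((‖α‖ ^ n * ‖β‖ : ℝ) : ℂ) * Complex.exp (((n * α.arg - β.arg : ℝ) : ℂ) * Complex.I) := by
    conv_lhs => rw [← Complex.norm_mul_exp_arg_mul_I α, ← Complex.norm_mul_exp_arg_mul_I β]
    rw [map_mul, ← Complex.exp_conj, mul_pow, ← Complex.exp_nat_mul]
    simp only [map_mul, Complex.conj_ofReal, Complex.conj_I]
    rw [show ∀ p q r s : ℂ, p * q * (r * s) = p * r * (q * s) by intros; ring, ← Complex.exp_add]
    push_cast
    congr 2
    ring
  rw [h1, Complex.im_ofReal_mul, Complex.exp_ofReal_mul_I_im]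

/-- sign at extremal points -/
lemma aux_sign (R ρ b y S V D : ℝ) (n : ℕ) (hR : |ρ| < R) (hy : 0 < y) (hyb : y ≤ b)
    (hD : 0 < D) (hV : D * V = R ^ (n + 2) * b * S + y * ρ ^ (n + 2)) :
    (S = 1 → 0 < V) ∧ (S = -1 → V < 0) := by
  have h1 : |ρ| ^ (n + 2) < R ^ (n + 2) := pow_lt_pow_left₀ hR (abs_nonneg _) (by omega)
  rw [← abs_pow] at h1
  obtain ⟨h2, h3⟩ := abs_lt.mp h1
  have hRp : 0 < R ^ (n + 2) := (abs_nonneg _).trans_lt h1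
  constructor
  · rintro rfl
    have : 0 < D * V := by rw [hV]; nlinarith
    exact (mul_pos_iff_of_pos_left hD).mp this
  · rintro rfl
    have : 0 < D * (-V) := by nlinarith
    linarith [(mul_pos_iff_of_pos_left hD).mp this]

/-- a long interval contains extremal points -/
lemma aux_ext (u v : ℝ) (h : u + 2 * Real.pi ≤ v) :
    (∃ w ∈ Set.Icc u v, Real.sin w = 1) ∧ (∃ w ∈ Set.Icc u v, Real.sin w = -1) := by
  have hp := Real.two_pi_pos
  constructor
  · obtain ⟨w, hw, he⟩ := Real.sin_periodic.exists_mem_Ico hp (Real.pi / 2) u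
    exact ⟨w, ⟨hw.1, hw.2.le.trans h⟩, by rw [← he, Real.sin_pi_div_two]⟩
  · obtain ⟨w, hw, he⟩ := Real.sin_periodic.exists_mem_Ico hp (-(Real.pi / 2)) u
    exact ⟨w, ⟨hw.1, hw.2.le.trans h⟩, by rw [← he, Real.sin_neg, Real.sin_pi_div_two]⟩

lemma aux_arg (α β : ℂ) (h : α.arg = β.arg) : 
    α.re ^ 2 * ‖β‖ ^ 2 = β.re ^ 2 * ‖α‖ ^ 2 := by
  have h1 := Complex.norm_mul_cos_arg α
  have h2 := Complex.norm_mul_cos_arg β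
  rw [← h1, ← h2, h]; ring

lemma aux_main (a : ℝ) (H : ℕ → Polynomial ℝ)
    (h0 : H 0 = 1) (h1 : H 1 = C (-1)) (h2 : H 2 = C (1 - a))
    (hrec : ∀ m, H (m + 3) + H (m + 2) + C a * H (m + 1) + X * H m = 0)
    (ρ₁ ρ₂ : ℝ) (hlt : ρ₁ < ρ₂)
    (hpos : ∀ ρ ∈ Set.Icc ρ₁ ρ₂, 0 < 3 * ρ ^ 2 + 2 * ρ + 4 * a - 1)
    (hdom : ∀ ρ ∈ Set.Icc ρ₁ ρ₂, 0 < ρ + a) :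
    ∃ m, ∃ ρ ∈ Set.Icc ρ₁ ρ₂, (H m).eval (-(ρ ^ 3 + ρ ^ 2 + a * ρ)) = 0 := by
  set y : ℝ → ℝ := fun ρ => Real.sqrt ((3 * ρ ^ 2 + 2 * ρ + 4 * a - 1) / 4) with hydef
  set α : ℝ → ℂ := fun ρ => ⟨-(1 + ρ) / 2, y ρ⟩ with hα
  set β : ℝ → ℂ := fun ρ => ⟨-(1 + ρ) / 2 - ρ, y ρ⟩ with hβ
  have hypos : ∀ ρ ∈ Set.Icc ρ₁ ρ₂, 0 < y ρ := fun ρ hρ =>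
    Real.sqrt_pos.mpr (by linarith [hpos ρ hρ])
  have hysq : ∀ ρ ∈ Set.Icc ρ₁ ρ₂, (-(1 + ρ) / 2) ^ 2 + y ρ ^ 2 = ρ ^ 2 + ρ + a := fun ρ hρ => by
    simp only [hydef]
    rw [Real.sq_sqrt (by linarith [hpos ρ hρ])]; ring
  have hyc : Continuous y := by fun_prop
  have hαc : Continuous α := by
    have : α = fun ρ => ((-(1 + ρ) / 2 : ℝ) : ℂ) + (y ρ : ℂ) * Complex.I := by
      funext ρ; apply Complex.ext <;> simp [hα]
    rw [this]; fun_prop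
  have hβc : Continuous β := by
    have : β = fun ρ => ((-(1 + ρ) / 2 - ρ : ℝ) : ℂ) + (y ρ : ℂ) * Complex.I := by
      funext ρ; apply Complex.ext <;> simp [hβ]
    rw [this]; fun_prop
  have hargα : ContinuousOn (fun ρ => (α ρ).arg) (Set.Icc ρ₁ ρ₂) := fun ρ hρ =>
    ((Complex.continuousAt_arg (Or.inr (hypos ρ hρ).ne')).comp hαc.continuousAt).continuousWithinAt
  have hargβ : ContinuousOn (fun ρ => (β ρ).arg) (Set.Icc ρ₁ ρ₂) := fun ρ hρ =>
    ((Complex.continuousAt_arg (Or.inr (hypos ρ hρ).ne')).comp hβc.continuousAt).continuousWithinAt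
  have hnα : ∀ ρ ∈ Set.Icc ρ₁ ρ₂, ‖α ρ‖ ^ 2 = ρ ^ 2 + ρ + a := fun ρ hρ => by
    rw [← hysq ρ hρ, Complex.sq_norm, Complex.normSq_mk]; ring
  -- two points with different arguments
  obtain ⟨p, hp, q, hq, hpq⟩ : ∃ p ∈ Set.Icc ρ₁ ρ₂, ∃ q ∈ Set.Icc ρ₁ ρ₂,
      (α p).arg < (α q).arg := by
    by_contra! hcon
    have hall : ∀ p ∈ Set.Icc ρ₁ ρ₂, ∀ q ∈ Set.Icc ρ₁ ρ₂, (α p).arg = (α q).arg :=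
      fun p hp q hq => le_antisymm (hcon q hq p hp) (hcon p hp q hq)
    set c := (ρ₁ + ρ₂) / 2 with hc
    have m1 : ρ₁ ∈ Set.Icc ρ₁ ρ₂ := ⟨le_rfl, hlt.le⟩
    have m2 : ρ₂ ∈ Set.Icc ρ₁ ρ₂ := ⟨hlt.le, le_rfl⟩
    have m3 : c ∈ Set.Icc ρ₁ ρ₂ := ⟨by linarith, by linarith⟩
    have A : ∀ ρ ∈ Set.Icc ρ₁ ρ₂, (1 + ρ₁) ^ 2 * (ρ ^ 2 + ρ + a) = 
        (1 + ρ) ^ 2 * (ρ₁ ^ 2 + ρ₁ + a) := fun ρ hρ => by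
      have := aux_arg _ _ (hall ρ₁ m1 ρ hρ)
      rw [hnα ρ hρ, hnα ρ₁ m1] at this
      simp only [hα] at this
      linear_combination 4 * this
    have e2 := A ρ₂ m2
    have e3 := A c m3
    set N := ρ₁ ^ 2 + ρ₁ + a with hN
    set M := (1 + ρ₁) ^ 2 with hM
    have hNp : 0 < N := by nlinarith [hdom ρ₁ m1, sq_nonneg ρ₁]
    have hMN : M * (ρ₁ ^ 2 + ρ₁ + a) = (1 + ρ₁) ^ 2 * N := by rw [hN, hM]
    have d2 : (ρ₂ - ρ₁) * ((M - N) * (ρ₂ + ρ₁) + (M - 2 * N)) = 0 := by linear_combination e2 - hMN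
    have d3 : (c - ρ₁) * ((M - N) * (c + ρ₁) + (M - 2 * N)) = 0 := by linear_combination e3 - hMN
    have d2' := (mul_eq_zero.mp d2).resolve_left (by linarith)
    have d3' := (mul_eq_zero.mp d3).resolve_left (by intro; linarith)
    have d4 : (M - N) * (ρ₂ - c) = 0 := by linear_combination d2' - d3'
    have d5 := (mul_eq_zero.mp d4).resolve_right (by intro; linarith)
    rw [d5] at d2'
    linarith
  -- pick m
  have hδ : 0 < (α q).arg - (α p).arg := by linarith
  obtain ⟨m, hm⟩ := exists_nat_gt (4 * Real.pi / ((α q).arg - (α p).arg))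
  rw [div_lt_iff₀ hδ] at hm
  set g : ℝ → ℝ := fun ρ => ((m + 2 : ℕ) : ℝ) * (α ρ).arg - (β ρ).arg with hg
  have hgc : ContinuousOn g (Set.Icc ρ₁ ρ₂) := by
    exact (continuousOn_const.mul hargα).sub hargβ
  have hgpq : g p + 2 * Real.pi ≤ g q := by
    simp only [hg]
    have b1 := Complex.arg_le_pi (β q)
    have b2 := Complex.neg_pi_lt_arg (β p)
    push_cast
    nlinarith
  have hsub : Set.Icc (g p) (g q) ⊆ g '' Set.Icc ρ₁ ρ₂ := 
    (isPreconnected_Icc.image g hgc).ordConnected.out ⟨p, hp, rfl⟩ ⟨q, hq, rfl⟩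
  obtain ⟨⟨w₁, hw₁, hs₁⟩, w₂, hw₂, hs₂⟩ := aux_ext _ _ hgpq
  obtain ⟨r₁, hr₁, rfl⟩ := hsub hw₁
  obtain ⟨r₂, hr₂, rfl⟩ := hsub hw₂
  have S : ∀ ρ ∈ Set.Icc ρ₁ ρ₂,
      (Real.sin (g ρ) = 1 → 0 < (H m).eval (-(ρ ^ 3 + ρ ^ 2 + a * ρ))) ∧ 
      (Real.sin (g ρ) = -1 → (H m).eval (-(ρ ^ 3 + ρ ^ 2 + a * ρ)) < 0) := fun ρ hρ => by
    have hy0 := hypos ρ hρ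
    have hf := aux_formula a H h0 h1 h2 hrec ρ _ (y ρ) rfl (hysq ρ hρ) m
    have hpol := aux_polar (α ρ) (β ρ) (m + 2)
    have hconj : (starRingEnd ℂ) (β ρ) = ⟨-(1 + ρ) / 2 - ρ, -y ρ⟩ := rfl
    rw [hconj] at hpol
    rw [hpol] at hf
    refine aux_sign ‖α ρ‖ ρ ‖β ρ‖ (y ρ) _ _ _ m ?_ hy0 ?_ ?_ hf
    · apply abs_lt_of_sq_lt_sq _ (norm_nonneg _) |> abs_lt.mpr ∘ abs_lt.mp
      rw [hnα ρ hρ]; linarith [hdom ρ hρ]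
    · exact (le_abs_self _).trans (Complex.abs_im_le_norm (β ρ))
    · positivity
  have hcont : ContinuousOn (fun ρ : ℝ => (H m).eval (-(ρ ^ 3 + ρ ^ 2 + a * ρ))) (Set.Icc ρ₁ ρ₂) := by
    apply Continuous.continuousOn
    exact (H m).continuous.comp (by fun_prop)
  obtain ⟨ρ, hρ, he⟩ := (isPreconnected_Icc.image _ hcont).ordConnected.out
    ⟨r₂, hr₂, rfl⟩ ⟨r₁, hr₁, rfl⟩ ⟨((S r₂ hr₂).2 hs₂).le, ((S r₁ hr₁).1 hs₁).le⟩
  exact ⟨m, ρ, hρ, he⟩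

/-- If `-1 ≤ a ≤ 1/3`, the union of the zero sets of the `H_m` is dense in
`I_a = (-∞, (-2 + 9a - 2√((1 - 3a)³))/27]`. -/
theorem stmt_4 (a : ℝ) (ha1 : -1 ≤ a) (ha2 : a ≤ 1 / 3) (H : ℕ → Polynomial ℝ)
    (h0 : H 0 = 1) (h1 : H 1 = C (-1)) (h2 : H 2 = C (1 - a))
    (hrec : ∀ m, H (m + 3) + H (m + 2) + C a * H (m + 1) + X * H m = 0) :
    Set.Iic ((-2 + 9 * a - 2 * Real.sqrt ((1 - 3 * a) ^ 3)) / 27)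
      ⊆ closure (⋃ m : ℕ, {x : ℝ | (H m).eval x = 0}) := by
  intro z hz
  obtain ⟨s, hs0, hs⟩ : ∃ s : ℝ, 0 ≤ s ∧ s ^ 2 = 1 - 3 * a :=
    ⟨Real.sqrt (1 - 3 * a), Real.sqrt_nonneg _, Real.sq_sqrt (by linarith)⟩
  have hs2 : s ≤ 2 := by nlinarith
  have ha : a = (1 - s ^ 2) / 3 := by linarith
  have hsq : Real.sqrt ((1 - 3 * a) ^ 3) = s ^ 3 := by
    rw [← hs, show (s ^ 2) ^ 3 = (s ^ 3) ^ 2 by ring, Real.sqrt_sq (by positivity)]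
  rw [Set.mem_Iic, hsq] at hz
  set Z : ℝ → ℝ := fun ρ => -(ρ ^ 3 + ρ ^ 2 + a * ρ) with hZ
  have hZc : Continuous Z := by fun_prop
  set r0 := (-1 + 2 * s) / 3 with hr0
  have hZ0 : Z r0 = (-2 + 9 * a - 2 * s ^ 3) / 27 := by
    simp only [hZ, hr0, ha]; ring
  -- surjectivity
  obtain ⟨ρ, hρ, hρz⟩ : ∃ ρ, r0 ≤ ρ ∧ Z ρ = z := by
    set B := |z| + 3 with hB
    have hz0 := abs_nonneg z
    have hBr : r0 ≤ B := by rw [hr0]; linarith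
    have hZB : Z B ≤ z := by
      have := neg_abs_le z
      simp only [hZ]
      have hb3 : 3 ≤ B := by linarith
      have : B * (B ^ 2 + B + a) ≥ B * 1 := by
        apply mul_le_mul_of_nonneg_left _ (by linarith)
        nlinarith
      nlinarith
    obtain ⟨ρ, hρ, he⟩ := intermediate_value_Icc' hBr hZc.continuousOn ⟨hZB, by rw [hZ0]; exact hz⟩
    exact ⟨ρ, hρ.1, he⟩
  have hcl : ρ ∈ closure {r : ℝ | ∃ m, (H m).eval (Z r) = 0} := by
    rw [Metric.mem_closure_iff]
    intro ε hε
    have hgt : ∀ r ∈ Set.Icc (ρ + ε / 3) (ρ + ε / 2), 2 * s < 3 * r + 1 := fun r hr => by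
      have := hr.1
      rw [hr0] at hρ
      linarith
    obtain ⟨m, r, hr, he⟩ := aux_main a H h0 h1 h2 hrec (ρ + ε / 3) (ρ + ε / 2) (by linarith)
      (fun r hr => by nlinarith [hgt r hr])
      (fun r hr => by nlinarith [hgt r hr, mul_nonneg hs0 (sub_nonneg.mpr hs2)])
    refine ⟨r, ⟨m, he⟩, ?_⟩
    rw [Real.dist_eq, abs_lt]
    constructor <;> linarith [hr.1, hr.2]
  have := image_closure_subset_closure_image hZc ⟨ρ, hcl, hρz⟩
  refine closure_mono ?_ this
  rintro _ ⟨r, ⟨m, hm⟩, rfl⟩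
  exact Set.mem_iUnion.mpr ⟨m, hm⟩
end

section
/- For every a ∈ (−1, 1/3) and every θ ∈ (2π/3, π) with 1 − 4a·cos²θ ≠ 0, the real number ζ(θ) = ((2a − 1)cos θ + √((1 − 4a)cos²θ + a)) / (1 − 4a·cos²θ) satisfies |ζ(θ)| > 1. -/
/-- For `a ∈ (-1, 1/3)` and `θ ∈ (2π/3, π)` with `1 - 4a·cos²θ ≠ 0`, the real number
`ζ(θ)` satisfies `|ζ(θ)| > 1`. -/
theorem stmt_8 (a θ : ℝ) (ha : a ∈ Set.Ioo (-1 : ℝ) (1 / 3))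
    (hθ : θ ∈ Set.Ioo (2 * Real.pi / 3) Real.pi)
    (hden : 1 - 4 * a * Real.cos θ ^ 2 ≠ 0) :
    1 < |((2 * a - 1) * Real.cos θ + Real.sqrt ((1 - 4 * a) * Real.cos θ ^ 2 + a)) /
          (1 - 4 * a * Real.cos θ ^ 2)| := by
  obtain ⟨ha1, ha2⟩ := ha
  obtain ⟨h1, h2⟩ := hθ
  have hpi := Real.pi_pos
  have hc1 : -1 < Real.cos θ := by
    rw [← Real.cos_pi]
    exact Real.cos_lt_cos_of_nonneg_of_le_pi (by linarith) le_rfl h2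
  have hc2 : Real.cos θ < -(1 / 2) := by
    have h : Real.cos (2 * Real.pi / 3) = -(1 / 2) := by
      rw [show 2 * Real.pi / 3 = Real.pi - Real.pi / 3 by ring, Real.cos_pi_sub,
        Real.cos_pi_div_three]
    rw [← h]
    exact Real.cos_lt_cos_of_nonneg_of_le_pi (by linarith) h2.le h1
  obtain ⟨x, hx⟩ : ∃ x, x = -Real.cos θ := ⟨_, rfl⟩
  have hcx : Real.cos θ = -x := by linarith
  rw [hcx] at hden hc1 hc2 ⊢
  have hx1 : 1 / 2 < x := by linarith
  have hx2 : x < 1 := by linarith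
  set S := Real.sqrt ((1 - 4 * a) * (-x) ^ 2 + a) with hS
  have hN : 0 < (2 * a - 1) * -x + S := by
    have : 0 ≤ S := Real.sqrt_nonneg _
    nlinarith
  rw [abs_div, abs_of_pos hN, one_lt_div (abs_pos.mpr hden)]
  rcases lt_or_gt_of_ne hden with hD | hD
  · rw [abs_of_neg hD]
    have hq : 0 < (1 + 2 * x) * (1 - a * (1 + 2 * x)) := by
      apply mul_pos (by linarith)
      nlinarith
    have : -(1 - 4 * a * (-x) ^ 2) - (1 - 2 * a) * x < S := by
      apply Real.lt_sqrt_of_sq_lt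
      nlinarith [mul_pos (neg_pos.mpr hD) hq]
    linarith
  · rw [abs_of_pos hD]
    have hq : 0 < (2 * x - 1) * (1 + a * (2 * x - 1)) := by
      apply mul_pos (by linarith)
      nlinarith
    have : (1 - 4 * a * (-x) ^ 2) - (1 - 2 * a) * x < S := by
      apply Real.lt_sqrt_of_sq_lt
      nlinarith [mul_pos hD hq]
    linarith
end

section
/- Let θ ∈ (π/3, π/2), ζ = −1/(2cos θ), and z = 2cos θ/√((1 − 4cos²θ)³). Then the three complex numbers t₀ = −e^{−iθ}/(z(2cos θ + ζ)), t₁ = t₀e^{2iθ}, and t₂ = ζ t₀ e^{iθ} are zeros of the cubic polynomial 1 + t² + z·t³. -/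
open Complex

/-- For `θ ∈ (π/3, π/2)`, `ζ = -1/(2cos θ)` and `z = 2cos θ/√((1 - 4cos²θ)³)`, the
numbers `t₀`, `t₁ = t₀e^{2iθ}`, `t₂ = ζt₀e^{iθ}` are zeros of `1 + t² + zt³`. -/
theorem stmt_16 (θ : ℝ) (hθ : θ ∈ Set.Ioo (Real.pi / 3) (Real.pi / 2))
    (ζ z : ℝ)
    (hζ : ζ = -1 / (2 * Real.cos θ))
    (hz : z = 2 * Real.cos θ / Real.sqrt ((1 - 4 * Real.cos θ ^ 2) ^ 3))
    (t₀ t₁ t₂ : ℂ)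
    (ht₀ : t₀ = -Complex.exp (-(θ : ℂ) * I) / ((z : ℂ) * (2 * Real.cos θ + (ζ : ℂ))))
    (ht₁ : t₁ = t₀ * Complex.exp (2 * θ * I))
    (ht₂ : t₂ = (ζ : ℂ) * t₀ * Complex.exp (θ * I)) :
    (1 + t₀ ^ 2 + (z : ℂ) * t₀ ^ 3 = 0) ∧
    (1 + t₁ ^ 2 + (z : ℂ) * t₁ ^ 3 = 0) ∧
    (1 + t₂ ^ 2 + (z : ℂ) * t₂ ^ 3 = 0) := by
  obtain ⟨h1, h2⟩ := hθ
  have hpi := Real.pi_pos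
  have hc0 : 0 < Real.cos θ := Real.cos_pos_of_mem_Ioo ⟨by linarith, h2⟩
  have hc1 : Real.cos θ < 1 / 2 := by
    rw [← Real.cos_pi_div_three]
    exact Real.cos_lt_cos_of_nonneg_of_le_pi (by linarith) (by linarith) h1
  have hd : 0 < 1 - 4 * Real.cos θ ^ 2 := by nlinarith
  obtain ⟨r, hr, hr2⟩ : ∃ r : ℝ, 0 < r ∧ r ^ 2 = 1 - 4 * Real.cos θ ^ 2 :=
    ⟨_, Real.sqrt_pos.2 hd, Real.sq_sqrt hd.le⟩
  have hs : Real.sqrt ((1 - 4 * Real.cos θ ^ 2) ^ 3) = r ^ 3 := by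
    rw [← hr2, show (r ^ 2) ^ 3 = (r ^ 3) ^ 2 by ring]
    exact Real.sqrt_sq (by positivity)
  rw [hs] at hz
  obtain ⟨c, hc⟩ : ∃ c : ℝ, c = 2 * Real.cos θ := ⟨_, rfl⟩
  have hcp : c ≠ 0 := by rw [hc]; positivity
  have hw : z * (c + ζ) = -1 / r := by
    rw [hz, hζ, ← hc]
    have : r ^ 2 = 1 - c ^ 2 := by rw [hr2, hc]; ring
    field_simp
    linarith
  have hrC : (r : ℂ) ≠ 0 := by exact_mod_cast hr.ne'
  have hcC : (c : ℂ) ≠ 0 := by exact_mod_cast hcp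
  have hwC : (z : ℂ) * (2 * Real.cos θ + (ζ : ℂ)) = -1 / r := by
    have : (2 * Real.cos θ : ℂ) = (c : ℂ) := by rw [hc]; push_cast; rfl
    rw [this]; exact_mod_cast hw
  have hr2C : (r : ℂ) ^ 2 = 1 - (c : ℂ) ^ 2 := by
    have : r ^ 2 = 1 - c ^ 2 := by rw [hr2, hc]; ring
    exact_mod_cast this
  have hzC : (z : ℂ) * (r : ℂ) ^ 3 = c := by
    have : z * r ^ 3 = c := by rw [hz, ← hc]; field_simp
    exact_mod_cast this
  have hζC : (ζ : ℂ) * c = -1 := by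
    have : ζ * c = -1 := by rw [hζ, ← hc]; field_simp
    exact_mod_cast this
  have hEF : Complex.exp (θ * I) * Complex.exp (-(θ : ℂ) * I) = 1 := by
    rw [← Complex.exp_add]; simp
  have hsum : Complex.exp (θ * I) + Complex.exp (-(θ : ℂ) * I) = c := by
    rw [hc]; push_cast; rw [Complex.two_cos]
  have hE2 : Complex.exp (2 * θ * I) = Complex.exp (θ * I) ^ 2 := by
    rw [← Complex.exp_nat_mul]; congr 1; push_cast; ring
  rw [hE2] at ht₁
  rw [hwC] at ht₀
  generalize Complex.exp (θ * I) = E at *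
  generalize Complex.exp (-(θ : ℂ) * I) = F at *
  have a0 : t₀ = F * r := by rw [ht₀]; field_simp
  have a1 : t₁ = E * r := by rw [ht₁, a0]; linear_combination E * r * hEF
  have a2 : t₂ = ζ * r := by rw [ht₂, a0]; linear_combination ζ * r * hEF
  have key : ∀ x : ℂ, 1 + x ^ 2 * (1 - (c : ℂ) ^ 2) + c * x ^ 3 = 0 →
      1 + (x * r) ^ 2 + (z : ℂ) * (x * r) ^ 3 = 0 := by
    intro x hx
    linear_combination hx + x ^ 2 * hr2C + x ^ 3 * hzC
  rw [a0, a1, a2]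
  refine ⟨key _ ?_, key _ ?_, key _ ?_⟩
  · have h : F ^ 2 - c * F + 1 = 0 := by linear_combination F * hsum - hEF
    linear_combination (1 + c * F) * h
  · have h : E ^ 2 - c * E + 1 = 0 := by linear_combination E * hsum - hEF
    linear_combination (1 + c * E) * h
  · have : (ζ : ℂ) = -1 / c := by rw [eq_div_iff hcC]; exact hζC
    rw [this]; field_simp; ring
end
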